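/- arXiv:2507.17122 — 10 statements merged into one kernel-verified Lean document; each statement's English description precedes it below -/
import Mathlib

section
/- Let X be a real Banach space of dimension at least 2. Then √2 ≤ H̃(X) ≤ 2. -/
noncomputable section

/-- Isosceles orthogonality: `x ⊥_I y` iff `‖x + y‖ = ‖x - y‖`. -/
def IsoOrth {X : Type*} [NormedAddCommGroup X] (x y : X) : Prop := ‖x + y‖ = ‖x - y‖

variable (X : Type*) [NormedAddCommGroup X] [NormedSpace ℝ X]

/-- The constant `H̃(X)`. -/
def Htilde : ℝ :=
  sSup {r : ℝ | ∃ x y : X, (x, y) ≠ (0, 0) ∧ IsoOrth x y ∧ r = (‖x‖ + ‖y‖) / ‖x + y‖}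

/-- The constant `A₂(X)`. -/
def A2 : ℝ :=
  sSup {r : ℝ | ∃ x y : X, ‖x‖ = 1 ∧ ‖y‖ = 1 ∧ r = (‖x + y‖ + ‖x - y‖) / 2}

/-- Clarkson's modulus of convexity `δ_X(ε)`. -/
def modulusConvexity (ε : ℝ) : ℝ :=
  sInf {r : ℝ | ∃ x y : X, ‖x‖ ≤ 1 ∧ ‖y‖ ≤ 1 ∧ ε ≤ ‖x - y‖ ∧ r = 1 - ‖x + y‖ / 2}

/-- The constant `H̃²(X)`. -/
def HtildeSq : ℝ :=
  sSup {r : ℝ | ∃ x y : X, (x, y) ≠ (0, 0) ∧ IsoOrth x y ∧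
    r = (‖x‖ ^ 2 + ‖y‖ ^ 2) / ‖x + y‖ ^ 2}

/-- The modified von Neumann–Jordan constant `C′_NJ(X)`. -/
def CNJmod : ℝ :=
  sSup {r : ℝ | ∃ x y : X, ‖x‖ = 1 ∧ ‖y‖ = 1 ∧ r = (‖x + y‖ ^ 2 + ‖x - y‖ ^ 2) / 4}

/-- The von Neumann–Jordan constant `C_NJ(X)`. -/
def CNJ : ℝ :=
  sSup {r : ℝ | ∃ x y : X, (x, y) ≠ (0, 0) ∧
    r = (‖x + y‖ ^ 2 + ‖x - y‖ ^ 2) / (2 * ‖x‖ ^ 2 + 2 * ‖y‖ ^ 2)}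

/-- The James constant in its isosceles-orthogonality form. -/
def JamesConst : ℝ :=
  sSup {r : ℝ | ∃ x y : X, ‖x‖ ≤ 1 ∧ ‖y‖ ≤ 1 ∧ IsoOrth x y ∧ r = ‖x + y‖}

/-- The constant `E_I(t, X)`. -/
def EI (t : ℝ) : ℝ :=
  sSup {r : ℝ | ∃ x y : X, (x, y) ≠ (0, 0) ∧ IsoOrth x y ∧
    r = (‖(t + 1) • x + (1 - t) • y‖ ^ 2 + ‖(1 - t) • x - (t + 1) • y‖ ^ 2) / ‖x + y‖ ^ 2}

/-- The skew constant `E(t, X)`. -/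
def Eskew (t : ℝ) : ℝ :=
  sSup {r : ℝ | ∃ x y : X, ‖x‖ = 1 ∧ ‖y‖ = 1 ∧ r = ‖x + t • y‖ ^ 2 + ‖t • x - y‖ ^ 2}

/-- The constant `L^I_YJ(τ, υ, X)`. -/
def LIYJ (τ υ : ℝ) : ℝ :=
  sSup {r : ℝ | ∃ x y : X, (x, y) ≠ (0, 0) ∧ IsoOrth x y ∧
    r = (‖(τ + υ) • x + (υ - τ) • y‖ ^ 2 + ‖(υ - τ) • x - (τ + υ) • y‖ ^ 2) /
      (υ ^ 2 * ‖x + y‖ ^ 2)}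

/-- The modified skew von Neumann–Jordan constant `L′_YJ(τ, υ, X)`. -/
def LYJmod (τ υ : ℝ) : ℝ :=
  sSup {r : ℝ | ∃ x y : X, ‖x‖ = 1 ∧ ‖y‖ = 1 ∧
    r = (‖τ • x + υ • y‖ ^ 2 + ‖υ • x - τ • y‖ ^ 2) / (2 * (τ ^ 2 + υ ^ 2))}

end

/-- The defining ratio of `Htilde` is at most `2`. -/
lemma IsoOrth.ratio_le_two {X : Type*} [NormedAddCommGroup X] [NormedSpace ℝ X] {x y : X}
    (h : IsoOrth x y) : (‖x‖ + ‖y‖) / ‖x + y‖ ≤ 2 := by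
  unfold IsoOrth at h
  have hx : 2 * ‖x‖ ≤ ‖x + y‖ + ‖x - y‖ := by
    calc 2 * ‖x‖ = ‖(x + y) + (x - y)‖ := by
          rw [show (x + y) + (x - y) = (2 : ℝ) • x by module, norm_smul]; norm_num
      _ ≤ _ := norm_add_le _ _
  have hy : 2 * ‖y‖ ≤ ‖x + y‖ + ‖x - y‖ := by
    calc 2 * ‖y‖ = ‖(x + y) - (x - y)‖ := by
          rw [show (x + y) - (x - y) = (2 : ℝ) • y by module, norm_smul]; norm_num
      _ ≤ _ := norm_sub_le _ _
  exact div_le_of_le_mul₀ (norm_nonneg _) (by norm_num) (by linarith)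

lemma IsoOrth.ratio_le_Htilde {X : Type*} [NormedAddCommGroup X] [NormedSpace ℝ X] {x y : X}
    (h : IsoOrth x y) (hx : x ≠ 0) : (‖x‖ + ‖y‖) / ‖x + y‖ ≤ Htilde X := by
  refine le_csSup ⟨2, ?_⟩ ⟨x, y, fun h0 => hx (Prod.ext_iff.mp h0).1, h, rfl⟩
  rintro r ⟨x, y, -, hxy, rfl⟩
  exact hxy.ratio_le_two

/-- In dimension at least two there are unit vectors which are isosceles orthogonal. -/
lemma exists_unit_isoOrth {X : Type*} [NormedAddCommGroup X] [NormedSpace ℝ X]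
    (hdim : 1 < Module.rank ℝ X) : ∃ u v : X, ‖u‖ = 1 ∧ ‖v‖ = 1 ∧ IsoOrth u v := by
  have hconn := isConnected_sphere hdim (0 : X) zero_le_one
  obtain ⟨u, hu⟩ := hconn.nonempty
  have hu' : ‖u‖ = 1 := by simpa using hu
  have hneg : -u ∈ Metric.sphere (0 : X) 1 := by simpa using hu'
  have hcont : ContinuousOn (fun v : X => ‖u + v‖ - ‖u - v‖) (Metric.sphere (0 : X) 1) := by
    fun_prop
  obtain ⟨v, hv, h⟩ := hconn.isPreconnected.intermediate_value hneg hu hcont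
    (show (0 : ℝ) ∈ Set.Icc _ _ by constructor <;> simp)
  exact ⟨u, v, hu', by simpa using hv, sub_eq_zero.mp h⟩

/-- Let `X` be a real Banach space of dimension at least 2.
Then `√2 ≤ H̃(X) ≤ 2`. -/
theorem stmt0 (X : Type*) [NormedAddCommGroup X] [NormedSpace ℝ X] [CompleteSpace X]
    (hdim : 2 ≤ Module.rank ℝ X) :
    Real.sqrt 2 ≤ Htilde X ∧ Htilde X ≤ 2 := by
  obtain ⟨u, v, hu, hv, huv⟩ :=
    exists_unit_isoOrth (X := X) (lt_of_lt_of_le (by norm_num) hdim)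
  have hsum : (u + v) + (u - v) = (2 : ℝ) • u := by module
  have hdiff : (u + v) - (u - v) = (2 : ℝ) • v := by module
  have horth : IsoOrth (u + v) (u - v) := by
    unfold IsoOrth
    rw [hsum, hdiff, norm_smul, norm_smul, hu, hv]
  have hu0 : u ≠ 0 := norm_ne_zero_iff.mp (by simp [hu])
  have hne : u + v ≠ 0 := by
    intro h0
    have h1 : u - v = 0 := norm_eq_zero.mp (by rw [← huv, h0, norm_zero])
    rw [h0, h1, add_zero] at hsum
    exact hu0 ((smul_eq_zero.mp hsum.symm).resolve_left two_ne_zero)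
  have h1 := huv.ratio_le_Htilde hu0
  have h2 := horth.ratio_le_Htilde hne
  rw [hu, hv] at h1
  rw [hsum, ← huv, norm_smul, hu] at h2
  have ha : 0 < ‖u + v‖ := norm_pos_iff.mpr hne
  have h2' : ‖u + v‖ ≤ Htilde X := by
    norm_num at h2
    linarith
  refine ⟨?_, csSup_le ⟨_, u, v, fun h0 => hu0 (Prod.ext_iff.mp h0).1, huv, rfl⟩ ?_⟩
  · have hpos : 0 ≤ Htilde X := ha.le.trans h2'
    rw [div_le_iff₀ ha] at h1
    exact Real.sqrt_le_iff.mpr ⟨hpos, by nlinarith⟩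
  · rintro r ⟨x, y, -, hxy, rfl⟩
    exact hxy.ratio_le_two
end

section
/- Let X be a nontrivial real Banach space. Then H̃(X) = A₂(X). -/
/-- `H̃(X) = A₂(X)` for a nontrivial real Banach space `X`. -/
theorem stmt1 (X : Type*) [NormedAddCommGroup X] [NormedSpace ℝ X] [CompleteSpace X]
    [Nontrivial X] :
    Htilde X = A2 X := by
  unfold Htilde A2
  congr 1
  ext r
  constructor
  · rintro ⟨x, y, hxy, h, rfl⟩
    have hd : ‖x + y‖ ≠ 0 := by
      intro h0
      have h1 : x + y = 0 := norm_eq_zero.mp h0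
      have h2 : x - y = 0 := norm_eq_zero.mp (h.symm.trans h0)
      have h3 : (2 : ℝ) • x = 0 := by
        rw [show (2 : ℝ) • x = (x + y) + (x - y) by module, h1, h2, add_zero]
      have hx : x = 0 := (smul_eq_zero.mp h3).resolve_left two_ne_zero
      have hy : y = 0 := by simpa [hx] using h1
      exact hxy (by rw [hx, hy])
    have hd' : ‖x - y‖ = ‖x + y‖ := h.symm
    set d := ‖x + y‖
    have key (z : X) : ‖d⁻¹ • z‖ = d⁻¹ * ‖z‖ := by
      rw [norm_smul, norm_inv, Real.norm_of_nonneg (norm_nonneg _)]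
    refine ⟨d⁻¹ • (x + y), d⁻¹ • (x - y), ?_, ?_, ?_⟩
    · rw [key]
      exact inv_mul_cancel₀ hd
    · rw [key, hd']
      exact inv_mul_cancel₀ hd
    · rw [← smul_add, ← smul_sub, key, key,
        show x + y + (x - y) = (2 : ℝ) • x by module,
        show x + y - (x - y) = (2 : ℝ) • y by module, norm_smul, norm_smul, Real.norm_two]
      field_simp
  · rintro ⟨u, v, hu, hv, rfl⟩
    have hsum : (2⁻¹ : ℝ) • (u + v) + (2⁻¹ : ℝ) • (u - v) = u := by module
    have hdiff : (2⁻¹ : ℝ) • (u + v) - (2⁻¹ : ℝ) • (u - v) = v := by module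
    refine ⟨(2⁻¹ : ℝ) • (u + v), (2⁻¹ : ℝ) • (u - v), ?_, ?_, ?_⟩
    · intro h
      rw [Prod.mk.injEq] at h
      rw [h.1, h.2, add_zero] at hsum
      simp [← hsum] at hu
    · rw [IsoOrth, hsum, hdiff, hu, hv]
    · rw [hsum, hu, norm_smul, norm_smul, norm_inv, Real.norm_two]
      ring
end

section
/- Let X be a nontrivial real Banach space. Then H̃(X) = 1 + sup{ε/2 − δ_X(ε) : √2 ≤ ε < 2}. -/
section NormSums

variable {X : Type*} [NormedAddCommGroup X] [NormedSpace ℝ X]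

/-- `x ↦ ‖x + y‖ + ‖x - y‖` is even and convex, hence monotone along rays. -/
lemma norm_smul_add_add_norm_smul_sub_le (u y : X) {a : ℝ} (ha0 : 0 ≤ a) (ha1 : a ≤ 1) :
    ‖a • u + y‖ + ‖a • u - y‖ ≤ ‖u + y‖ + ‖u - y‖ := by
  have h1 : a • u + y = ((1 + a) / 2) • (u + y) - ((1 - a) / 2) • (u - y) := by module
  have h2 : a • u - y = ((1 + a) / 2) • (u - y) - ((1 - a) / 2) • (u + y) := by module
  have hp : 0 ≤ (1 + a) / 2 := by linarith
  have hm : 0 ≤ (1 - a) / 2 := by linarith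
  have h3 := norm_sub_le (((1 + a) / 2) • (u + y)) (((1 - a) / 2) • (u - y))
  have h4 := norm_sub_le (((1 + a) / 2) • (u - y)) (((1 - a) / 2) • (u + y))
  rw [← h1] at h3
  rw [← h2] at h4
  simp only [norm_smul, Real.norm_of_nonneg hp, Real.norm_of_nonneg hm] at h3 h4
  linarith

lemma exists_norm_eq_one_smul_eq [Nontrivial X] (x : X) : ∃ u : X, ‖u‖ = 1 ∧ x = ‖x‖ • u := by
  by_cases hx : x = 0
  · obtain ⟨u, hu⟩ := exists_norm_eq X zero_le_one
    exact ⟨u, hu, by simp [hx]⟩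
  · have hn : ‖x‖ ≠ 0 := norm_ne_zero_iff.mpr hx
    exact ⟨‖x‖⁻¹ • x, by simp [norm_smul, hn], by rw [smul_smul, mul_inv_cancel₀ hn, one_smul]⟩

lemma exists_unit_norm_add_add_norm_sub_le [Nontrivial X] {x y : X}
    (hx : ‖x‖ ≤ 1) (hy : ‖y‖ ≤ 1) :
    ∃ u v : X, ‖u‖ = 1 ∧ ‖v‖ = 1 ∧ ‖x + y‖ + ‖x - y‖ ≤ ‖u + v‖ + ‖u - v‖ := by
  obtain ⟨u, hu, hxu⟩ := exists_norm_eq_one_smul_eq x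
  obtain ⟨v, hv, hyv⟩ := exists_norm_eq_one_smul_eq y
  refine ⟨u, v, hu, hv, ?_⟩
  have h1 := norm_smul_add_add_norm_smul_sub_le u y (norm_nonneg x) hx
  have h2 := norm_smul_add_add_norm_smul_sub_le v u (norm_nonneg y) hy
  rw [← hxu] at h1
  rw [← hyv] at h2
  rw [add_comm y u, norm_sub_rev y u, add_comm v u, norm_sub_rev v u] at h2
  linarith

lemma two_mul_le_norm_smul_add_smul {u v : X} (hu : ‖u‖ = 1) (hv : ‖v‖ = 1) {p q c : ℝ}
    (hp : c ≤ p) (hq : c ≤ q) (hc : 0 ≤ c) : 2 * c ≤ ‖p • (u + v) + q • (u - v)‖ := by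
  have e : p • (u + v) + q • (u - v) = (p + q) • u - (q - p) • v := by module
  have h := norm_sub_norm_le ((p + q) • u) ((q - p) • v)
  rw [← e, norm_smul, norm_smul, hu, hv, Real.norm_of_nonneg (by linarith), Real.norm_eq_abs] at h
  rcases abs_cases (q - p) with ⟨h1, -⟩ | ⟨h1, -⟩ <;> rw [h1] at h <;> linarith

/-- If the sum and difference of two unit vectors are both shorter than `√2`, then normalizing
them gives unit vectors whose sum and difference are at least `√2`. -/
lemma exists_unit_sqrt_two_le {u v : X} (hu : ‖u‖ = 1) (hv : ‖v‖ = 1)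
    (ha : ‖u + v‖ < √2) (hb : ‖u - v‖ < √2) :
    ∃ u' v' : X, ‖u'‖ = 1 ∧ ‖v'‖ = 1 ∧ √2 ≤ ‖u' + v'‖ ∧ √2 ≤ ‖u' - v'‖ := by
  have hs : √2 * √2 = 2 := Real.mul_self_sqrt (by norm_num)
  have hs0 : 0 < √2 := by positivity
  have hs2 : √2 < 2 := by nlinarith
  have htwo : 2 ≤ ‖u + v‖ + ‖u - v‖ := by
    have h := norm_add_le (u + v) (u - v)
    rwa [show u + v + (u - v) = (2 : ℝ) • u by module, norm_smul, hu, Real.norm_two,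
      mul_one] at h
  have ha0 : 0 < ‖u + v‖ := by linarith
  have hb0 : 0 < ‖u - v‖ := by linarith
  have hc : 2 * (√2)⁻¹ = √2 := by field_simp; linarith
  have hai : (√2)⁻¹ ≤ ‖u + v‖⁻¹ := inv_anti₀ ha0 ha.le
  have hbi : (√2)⁻¹ ≤ ‖u - v‖⁻¹ := inv_anti₀ hb0 hb.le
  refine ⟨‖u + v‖⁻¹ • (u + v), ‖u - v‖⁻¹ • (u - v), ?_, ?_, ?_, ?_⟩
  · rw [norm_smul, norm_inv, norm_norm, inv_mul_cancel₀ ha0.ne']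
  · rw [norm_smul, norm_inv, norm_norm, inv_mul_cancel₀ hb0.ne']
  · have h := two_mul_le_norm_smul_add_smul hu hv hai hbi (by positivity)
    rwa [hc] at h
  · have h := two_mul_le_norm_smul_add_smul hv hu hai hbi (by positivity)
    rwa [hc, add_comm v u, ← neg_sub u v, smul_neg, ← sub_eq_add_neg] at h

end NormSums

section Constants

variable {X : Type*} [NormedAddCommGroup X]

lemma modulusConvexity_le {x y : X} (hx : ‖x‖ ≤ 1) (hy : ‖y‖ ≤ 1) {ε : ℝ} (h : ε ≤ ‖x - y‖) :
    modulusConvexity X ε ≤ 1 - ‖x + y‖ / 2 := by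
  refine csInf_le ⟨0, ?_⟩ ⟨x, y, hx, hy, h, rfl⟩
  rintro r ⟨x, y, hx, hy, -, rfl⟩
  linarith [norm_add_le x y]

variable [NormedSpace ℝ X]

lemma norm_le_norm_add_of_isoOrth {x y : X} (h : IsoOrth x y) :
    ‖x‖ ≤ ‖x + y‖ ∧ ‖y‖ ≤ ‖x + y‖ := by
  unfold IsoOrth at h
  have h1 := norm_add_le (x + y) (x - y)
  have h2 := norm_sub_le (x + y) (x - y)
  rw [show x + y + (x - y) = (2 : ℝ) • x by module, norm_smul, Real.norm_two] at h1
  rw [show x + y - (x - y) = (2 : ℝ) • y by module, norm_smul, Real.norm_two] at h2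
  constructor <;> linarith

lemma bddAbove_Htilde : BddAbove {r : ℝ | ∃ x y : X, (x, y) ≠ (0, 0) ∧ IsoOrth x y ∧
    r = (‖x‖ + ‖y‖) / ‖x + y‖} := by
  refine ⟨2, ?_⟩
  rintro r ⟨x, y, -, hxy, rfl⟩
  obtain ⟨h1, h2⟩ := norm_le_norm_add_of_isoOrth hxy
  exact div_le_of_le_mul₀ (norm_nonneg _) zero_le_two (by linarith)

lemma half_norm_add_add_norm_sub_le_Htilde [Nontrivial X] {x y : X}
    (hx : ‖x‖ ≤ 1) (hy : ‖y‖ ≤ 1) : (‖x + y‖ + ‖x - y‖) / 2 ≤ Htilde X := by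
  obtain ⟨u, v, hu, hv, huv⟩ := exists_unit_norm_add_add_norm_sub_le hx hy
  have e1 : u + v + (u - v) = (2 : ℝ) • u := by module
  have e2 : u + v - (u - v) = (2 : ℝ) • v := by module
  have hn : ‖u + v + (u - v)‖ = 2 := by rw [e1, norm_smul, hu, Real.norm_two, mul_one]
  refine le_trans (by rw [hn]; linarith) (le_csSup bddAbove_Htilde ⟨u + v, u - v, ?_, ?_, rfl⟩ :
    (‖u + v‖ + ‖u - v‖) / ‖u + v + (u - v)‖ ≤ Htilde X)
  · intro h
    rw [Prod.mk.injEq] at h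
    rw [h.1, h.2] at hn
    simp at hn
  · rw [IsoOrth, hn, e2, norm_smul, hv, Real.norm_two, mul_one]

lemma le_modulusConvexity [Nontrivial X] {ε c : ℝ} (hε : ε ≤ 2)
    (h : ∀ x y : X, ‖x‖ ≤ 1 → ‖y‖ ≤ 1 → ε ≤ ‖x - y‖ → c ≤ 1 - ‖x + y‖ / 2) :
    c ≤ modulusConvexity X ε := by
  obtain ⟨e, he⟩ := exists_norm_eq X zero_le_one
  refine le_csInf ⟨_, e, -e, he.le, by rw [norm_neg, he], ?_, rfl⟩ ?_
  · rwa [sub_neg_eq_add, ← two_smul ℝ e, norm_smul, he, Real.norm_two, mul_one]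
  · rintro r ⟨x, y, hx, hy, hxy, rfl⟩
    exact h x y hx hy hxy

lemma half_sub_modulusConvexity_le [Nontrivial X] {ε : ℝ} (hε : ε ≤ 2) :
    ε / 2 - modulusConvexity X ε ≤ Htilde X - 1 := by
  have : ε / 2 + 1 - Htilde X ≤ modulusConvexity X ε :=
    le_modulusConvexity hε fun x y hx hy hxy ↦ by
      linarith [half_norm_add_add_norm_sub_le_Htilde hx hy]
  linarith

lemma half_norm_add_add_norm_sub_le_sSup [Nontrivial X] {u v : X} (hu : ‖u‖ = 1) (hv : ‖v‖ = 1)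
    (h : √2 ≤ ‖u - v‖) :
    (‖u + v‖ + ‖u - v‖) / 2 ≤ 1 + sSup {r : ℝ | ∃ ε : ℝ, √2 ≤ ε ∧ ε < 2 ∧
      r = ε / 2 - modulusConvexity X ε} := by
  have key : ∀ ε : ℝ, √2 ≤ ε → ε < 2 → ε ≤ ‖u - v‖ →
      (‖u + v‖ + ε) / 2 ≤ 1 + sSup {r : ℝ | ∃ ε : ℝ, √2 ≤ ε ∧ ε < 2 ∧
        r = ε / 2 - modulusConvexity X ε} := by
    intro ε h1 h2 h3
    have hm := modulusConvexity_le hu.le hv.le h3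
    have hb : BddAbove {r : ℝ | ∃ ε : ℝ, √2 ≤ ε ∧ ε < 2 ∧
        r = ε / 2 - modulusConvexity X ε} := by
      refine ⟨Htilde X - 1, ?_⟩
      rintro r ⟨ε, -, h, rfl⟩
      exact half_sub_modulusConvexity_le h.le
    have := le_csSup hb ⟨ε, h1, h2, rfl⟩
    linarith
  have hs2 : √2 < 2 := by rw [Real.sqrt_lt' two_pos]; norm_num
  have hle : ‖u - v‖ ≤ 2 := by linarith [norm_sub_le u v]
  rcases hle.lt_or_eq with hlt | heq
  · exact key _ h hlt le_rfl
  · rw [heq]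
    refine le_of_forall_pos_le_add fun η hη ↦ ?_
    have := key (max √2 (2 - η)) (le_max_left _ _) (max_lt hs2 (by linarith))
      (by rw [heq]; exact max_le hs2.le (by linarith))
    linarith [le_max_right √2 (2 - η)]

lemma half_norm_add_add_norm_sub_le_sSup_of_unit [Nontrivial X] {u v : X}
    (hu : ‖u‖ = 1) (hv : ‖v‖ = 1) :
    (‖u + v‖ + ‖u - v‖) / 2 ≤ 1 + sSup {r : ℝ | ∃ ε : ℝ, √2 ≤ ε ∧ ε < 2 ∧
      r = ε / 2 - modulusConvexity X ε} := by
  rcases le_or_gt √2 ‖u - v‖ with hb | hb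
  · exact half_norm_add_add_norm_sub_le_sSup hu hv hb
  rcases le_or_gt √2 ‖u + v‖ with ha | ha
  · have := half_norm_add_add_norm_sub_le_sSup (v := -v) hu (by rwa [norm_neg])
      (by rwa [sub_neg_eq_add])
    rwa [sub_neg_eq_add, ← sub_eq_add_neg, add_comm ‖u - v‖] at this
  obtain ⟨u', v', hu', hv', h1, h2⟩ := exists_unit_sqrt_two_le hu hv ha hb
  linarith [half_norm_add_add_norm_sub_le_sSup hu' hv' h2]

end Constants

/-- `H̃(X) = 1 + sup{ε/2 − δ_X(ε) : √2 ≤ ε < 2}`. -/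
theorem stmt2 (X : Type*) [NormedAddCommGroup X] [NormedSpace ℝ X] [CompleteSpace X]
    [Nontrivial X] :
    Htilde X = 1 + sSup {r : ℝ | ∃ ε : ℝ, Real.sqrt 2 ≤ ε ∧ ε < 2 ∧
      r = ε / 2 - modulusConvexity X ε} := by
  have hs2 : √2 < 2 := by rw [Real.sqrt_lt' two_pos]; norm_num
  apply le_antisymm
  · obtain ⟨e, he⟩ := exists_ne (0 : X)
    refine csSup_le ⟨_, e, 0, by simp [he], by simp [IsoOrth], rfl⟩ ?_
    rintro r ⟨x, y, h0, hxy, rfl⟩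
    obtain ⟨hx, hy⟩ := norm_le_norm_add_of_isoOrth hxy
    have hn : 0 < ‖x + y‖ := by
      refine (norm_nonneg _).lt_of_ne fun h ↦ h0 ?_
      rw [← h] at hx hy
      rw [norm_le_zero_iff.mp hx, norm_le_zero_iff.mp hy]
    have hu : ‖‖x + y‖⁻¹ • (x + y)‖ = 1 := by
      rw [norm_smul, norm_inv, norm_norm, inv_mul_cancel₀ hn.ne']
    have hv : ‖‖x + y‖⁻¹ • (x - y)‖ = 1 := by
      rw [norm_smul, norm_inv, norm_norm, ← hxy, inv_mul_cancel₀ hn.ne']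
    refine le_trans (le_of_eq ?_) (half_norm_add_add_norm_sub_le_sSup_of_unit hu hv)
    rw [← smul_add, ← smul_sub, show x + y + (x - y) = (2 : ℝ) • x by module,
      show x + y - (x - y) = (2 : ℝ) • y by module]
    simp only [norm_smul, norm_inv, norm_norm, Real.norm_two]
    field_simp
  · have : sSup {r : ℝ | ∃ ε : ℝ, √2 ≤ ε ∧ ε < 2 ∧ r = ε / 2 - modulusConvexity X ε} ≤
        Htilde X - 1 := by
      refine csSup_le ⟨_, √2, le_rfl, hs2, rfl⟩ ?_
      rintro r ⟨ε, -, hε, rfl⟩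
      exact half_sub_modulusConvexity_le hε.le
    linarith
end

section
/- Let X be a nontrivial real Banach space. Then H̃²(X) = C′_NJ(X). -/
/-- `H̃²(X) = C′_NJ(X)` for a nontrivial real Banach space `X`. -/
theorem stmt3 (X : Type*) [NormedAddCommGroup X] [NormedSpace ℝ X] [CompleteSpace X]
    [Nontrivial X] :
    HtildeSq X = CNJmod X := by
  unfold HtildeSq CNJmod
  congr 1
  ext r
  constructor
  · rintro ⟨x, y, hxy, horth, rfl⟩
    unfold IsoOrth at horth
    have hn : ‖x + y‖ ≠ 0 := by
      intro h
      have hadd : x + y = 0 := norm_eq_zero.mp h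
      have hsub : x - y = 0 := norm_eq_zero.mp (horth ▸ h)
      have hx : x = 0 := by
        have h2 : (2 : ℝ) • x = (x + y) + (x - y) := by module
        rw [hadd, hsub, add_zero] at h2
        simpa using h2
      have hy : y = 0 := by simpa [hx] using hadd
      exact hxy (by rw [hx, hy])
    refine ⟨‖x + y‖⁻¹ • (x + y), ‖x + y‖⁻¹ • (x - y), ?_, ?_, ?_⟩
    · rw [norm_smul, norm_inv, norm_norm, inv_mul_cancel₀ hn]
    · rw [norm_smul, norm_inv, norm_norm, ← horth, inv_mul_cancel₀ hn]
    · have h1 : ‖x + y‖⁻¹ • (x + y) + ‖x + y‖⁻¹ • (x - y) = (2 * ‖x + y‖⁻¹) • x := by module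
      have h2 : ‖x + y‖⁻¹ • (x + y) - ‖x + y‖⁻¹ • (x - y) = (2 * ‖x + y‖⁻¹) • y := by module
      rw [h1, h2, norm_smul, norm_smul, norm_mul, norm_inv, norm_norm, Real.norm_two]
      field_simp
      ring
  · rintro ⟨u, v, hu, hv, rfl⟩
    have h1 : (u + v) + (u - v) = (2 : ℝ) • u := by module
    have h2 : (u + v) - (u - v) = (2 : ℝ) • v := by module
    have h3 : ‖(u + v) + (u - v)‖ = 2 := by rw [h1, norm_smul, hu, Real.norm_two, mul_one]
    have h4 : ‖(u + v) - (u - v)‖ = 2 := by rw [h2, norm_smul, hv, Real.norm_two, mul_one]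
    refine ⟨u + v, u - v, ?_, h3.trans h4.symm, ?_⟩
    · intro h
      rw [Prod.mk.injEq] at h
      rw [h.1, h.2, add_zero, norm_zero] at h3
      norm_num at h3
    · rw [h3]
      norm_num
end

section
/- Let X be a nontrivial real Banach space. Then H̃²(X) = 1 if and only if X is a Hilbert space, i.e., if and only if the norm of X is induced by an inner product (equivalently, the norm satisfies the parallelogram law). -/
/-- The binary quadratic form `a s² + 2 b s t + c t²` at `z = (s, t)`. -/
def binaryForm (a b c : ℝ) (z : ℝ × ℝ) : ℝ := a * z.1 ^ 2 + 2 * b * z.1 * z.2 + c * z.2 ^ 2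

lemma continuous_binaryForm (a b c : ℝ) : Continuous (binaryForm a b c) := by
  unfold binaryForm; fun_prop

lemma binaryForm_smul (a b c r : ℝ) (z : ℝ × ℝ) :
    binaryForm a b c (r • z) = r ^ 2 * binaryForm a b c z := by
  simp only [binaryForm, Prod.smul_fst, Prod.smul_snd, smul_eq_mul]; ring

lemma binaryForm_add_add_sub (a b c : ℝ) (u v : ℝ × ℝ) :
    binaryForm a b c (u + v) + binaryForm a b c (u - v) =
      2 * binaryForm a b c u + 2 * binaryForm a b c v := by
  simp only [binaryForm, Prod.fst_add, Prod.snd_add, Prod.fst_sub, Prod.snd_sub]; ring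

lemma binaryForm_pos {a b c : ℝ} (hD : 0 < a * c - b ^ 2) (h0 : ∀ z, 0 ≤ binaryForm a b c z)
    {z : ℝ × ℝ} (hz : z ≠ 0) : 0 < binaryForm a b c z := by
  have ha : 0 ≤ a := by simpa [binaryForm] using h0 (1, 0)
  have ha' : 0 < a := by
    rcases ha.eq_or_lt with h | h
    · rw [← h] at hD; nlinarith [sq_nonneg b]
    · exact h
  refine (h0 z).lt_of_ne fun h => hz ?_
  have key : (a * z.1 + b * z.2) ^ 2 + (a * c - b ^ 2) * z.2 ^ 2 = a * binaryForm a b c z := by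
    unfold binaryForm; ring
  rw [← h, mul_zero] at key
  have h2 : z.2 = 0 := by
    have : (a * c - b ^ 2) * z.2 ^ 2 ≤ 0 := by nlinarith [sq_nonneg (a * z.1 + b * z.2)]
    have : z.2 ^ 2 ≤ 0 := nonpos_of_mul_nonpos_right this hD
    exact pow_eq_zero_iff two_ne_zero |>.1 (le_antisymm this (sq_nonneg _))
  have h1 : z.1 = 0 := by
    rw [h2] at key
    have : (a * z.1) ^ 2 = 0 := by nlinarith
    have := pow_eq_zero_iff two_ne_zero |>.1 this
    exact (mul_eq_zero.1 this).resolve_left ha'.ne'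
  exact Prod.ext h1 h2

/-- A function homogeneous of degree two dominates another one as soon as it does on the sphere. -/
lemma le_of_le_on_sphere {F G : ℝ × ℝ → ℝ} (hF : ∀ (r : ℝ) z, F (r • z) = r ^ 2 * F z)
    (hG : ∀ (r : ℝ) z, G (r • z) = r ^ 2 * G z)
    (h : ∀ z ∈ Metric.sphere (0 : ℝ × ℝ) 1, G z ≤ F z) (z : ℝ × ℝ) : G z ≤ F z := by
  by_cases hz : z = 0
  · subst hz
    have h1 := hF 0 0
    have h2 := hG 0 0
    simp at h1 h2
    simp [h1, h2]
  · have hn : ‖z‖ ≠ 0 := norm_ne_zero_iff.2 hz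
    have hs : ‖z‖⁻¹ • z ∈ Metric.sphere (0 : ℝ × ℝ) 1 := by
      simp [norm_smul, hn]
    have h1 : z = ‖z‖ • (‖z‖⁻¹ • z) := by rw [smul_smul, mul_inv_cancel₀ hn, one_smul]
    rw [h1, hF, hG]
    exact mul_le_mul_of_nonneg_left (h _ hs) (sq_nonneg _)

lemma exists_maximal_binaryForm {F : ℝ × ℝ → ℝ} (hc : Continuous F)
    (hF : ∀ (r : ℝ) z, F (r • z) = r ^ 2 * F z) (hpos : ∀ z ≠ 0, 0 < F z) :
    ∃ a b c : ℝ, 0 < a * c - b ^ 2 ∧ (∀ z, 0 ≤ binaryForm a b c z) ∧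
      (∀ z, binaryForm a b c z ≤ F z) ∧
      ∀ a' b' c' : ℝ, (∀ z, 0 ≤ binaryForm a' b' c' z) → (∀ z, binaryForm a' b' c' z ≤ F z) →
        a' * c' - b' ^ 2 ≤ a * c - b ^ 2 := by
  let K : Set (ℝ × ℝ × ℝ) :=
    {p | (∀ z, 0 ≤ binaryForm p.1 p.2.1 p.2.2 z) ∧ ∀ z, binaryForm p.1 p.2.1 p.2.2 z ≤ F z}
  have hcont : ∀ z, Continuous fun p : ℝ × ℝ × ℝ => binaryForm p.1 p.2.1 p.2.2 z := by
    intro z; unfold binaryForm; fun_prop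
  have hclosed : IsClosed K := by
    refine IsClosed.and ?_ ?_
    · rw [Set.ofPred_forall]
      exact isClosed_iInter fun z => isClosed_le continuous_const (hcont z)
    · rw [Set.ofPred_forall]
      exact isClosed_iInter fun z => isClosed_le (hcont z) continuous_const
  have hsub : K ⊆ Set.Icc 0 (F (1, 0)) ×ˢ
      (Set.Icc (-F (1, -1)) (F (1, 1)) ×ˢ Set.Icc 0 (F (0, 1))) := by
    rintro ⟨a, b, c⟩ ⟨h0, h1⟩
    have e1 := h0 (1, 0)
    have e2 := h0 (0, 1)
    have e3 := h1 (1, 0)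
    have e4 := h1 (0, 1)
    have e5 := h1 (1, 1)
    have e6 := h1 (1, -1)
    have e7 := h0 (1, 1)
    have e8 := h0 (1, -1)
    norm_num [binaryForm] at e1 e2 e3 e4 e5 e6 e7 e8
    simp only [Set.mem_prod, Set.mem_Icc]
    refine ⟨⟨?_, ?_⟩, ⟨?_, ?_⟩, ?_, ?_⟩ <;> linarith
  have hK : IsCompact K :=
    (isCompact_Icc.prod (isCompact_Icc.prod isCompact_Icc)).of_isClosed_subset hclosed hsub
  obtain ⟨z₀, hz₀, hmin⟩ := (isCompact_sphere (0 : ℝ × ℝ) 1).exists_isMinOn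
    (NormedSpace.sphere_nonempty.2 zero_le_one) hc.continuousOn
  have hm : 0 < F z₀ := hpos _ (Metric.ne_of_mem_sphere hz₀ one_ne_zero)
  have hmem : ((F z₀ / 2, 0, F z₀ / 2) : ℝ × ℝ × ℝ) ∈ K := by
    refine ⟨fun z => ?_, le_of_le_on_sphere hF (binaryForm_smul _ _ _) fun z hz => ?_⟩
    · simp only [binaryForm]; nlinarith [mul_nonneg hm.le (sq_nonneg z.1), mul_nonneg hm.le (sq_nonneg z.2)]
    · refine le_trans ?_ (hmin hz)
      have hz' : ‖z‖ = 1 := by simpa using hz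
      have h1 : |z.1| ≤ 1 := hz' ▸ norm_fst_le z
      have h2 : |z.2| ≤ 1 := hz' ▸ norm_snd_le z
      have h1 := (sq_le_one_iff_abs_le_one _).2 h1
      have h2 := (sq_le_one_iff_abs_le_one _).2 h2
      simp only [binaryForm]
      nlinarith
  obtain ⟨p, hp, hmax⟩ := hK.exists_isMaxOn ⟨_, hmem⟩
    (f := fun p : ℝ × ℝ × ℝ => p.1 * p.2.2 - p.2.1 ^ 2) (by fun_prop)
  refine ⟨p.1, p.2.1, p.2.2, ?_, hp.1, hp.2, fun a' b' c' h0 h1 => ?_⟩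
  · refine lt_of_lt_of_le ?_ (hmax hmem)
    simp only
    nlinarith [mul_pos hm hm]
  · exact hmax (show (a', b', c') ∈ K from ⟨h0, h1⟩)

/-- A form of maximal discriminant below `F` touches `F` off any given line. -/
lemma exists_touching_off_line {F : ℝ × ℝ → ℝ} (hc : Continuous F)
    (hF : ∀ (r : ℝ) z, F (r • z) = r ^ 2 * F z) {a b c : ℝ} (hD : 0 < a * c - b ^ 2)
    (h0 : ∀ z, 0 ≤ binaryForm a b c z) (h1 : ∀ z, binaryForm a b c z ≤ F z)
    (hmax : ∀ a' b' c' : ℝ, (∀ z, 0 ≤ binaryForm a' b' c' z) →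
      (∀ z, binaryForm a' b' c' z ≤ F z) → a' * c' - b' ^ 2 ≤ a * c - b ^ 2)
    {u : ℝ × ℝ} (hu : u ≠ 0) :
    ∃ v, u.1 * v.2 - u.2 * v.1 ≠ 0 ∧ binaryForm a b c v = F v := by
  wlog hu1 : binaryForm a b c u = 1 generalizing u
  · have hq := binaryForm_pos hD h0 hu
    have hs : (0 : ℝ) < (√(binaryForm a b c u))⁻¹ := inv_pos.2 (Real.sqrt_pos.2 hq)
    obtain ⟨v, hv, hv'⟩ := this (u := (√(binaryForm a b c u))⁻¹ • u)
      (smul_ne_zero hs.ne' hu)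
      (by rw [binaryForm_smul, inv_pow, Real.sq_sqrt hq.le, inv_mul_cancel₀ hq.ne'])
    refine ⟨v, fun h => hv ?_, hv'⟩
    simp only [Prod.smul_fst, Prod.smul_snd, smul_eq_mul]
    linear_combination (√(binaryForm a b c u))⁻¹ * h
  set l : ℝ × ℝ → ℝ := fun z => (a * u.1 + b * u.2) * z.1 + (b * u.1 + c * u.2) * z.2 with hl
  have hlc : Continuous l := by fun_prop
  have hlag : ∀ z, binaryForm a b c z =
      l z ^ 2 + (a * c - b ^ 2) * (u.1 * z.2 - u.2 * z.1) ^ 2 := by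
    intro z
    have : binaryForm a b c u * binaryForm a b c z =
        l z ^ 2 + (a * c - b ^ 2) * (u.1 * z.2 - u.2 * z.1) ^ 2 := by
      simp only [binaryForm, hl]; ring
    rwa [hu1, one_mul] at this
  by_contra! hne
  have hqc := continuous_binaryForm a b c
  obtain ⟨ε, hε, hε2, hεF⟩ : ∃ ε : ℝ, 0 < ε ∧ ε < 1 / 2 ∧ ∀ z ∈ Metric.sphere (0 : ℝ × ℝ) 1,
      binaryForm a b c z + ε * (2 * binaryForm a b c z - 3 * l z ^ 2) ≤ F z := by
    let C : Set (ℝ × ℝ) :=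
      Metric.sphere (0 : ℝ × ℝ) 1 ∩ {z | 3 * l z ^ 2 ≤ 2 * binaryForm a b c z}
    have hC : IsCompact C :=
      (isCompact_sphere _ _).inter_right (isClosed_le (by fun_prop) (by fun_prop))
    have hout : ∀ ε : ℝ, 0 < ε → ∀ z ∈ Metric.sphere (0 : ℝ × ℝ) 1, z ∉ C →
        binaryForm a b c z + ε * (2 * binaryForm a b c z - 3 * l z ^ 2) ≤ F z := by
      intro ε hε z hz hzC
      have : 2 * binaryForm a b c z < 3 * l z ^ 2 := by
        by_contra! h
        exact hzC ⟨hz, h⟩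
      nlinarith [h1 z]
    rcases C.eq_empty_or_nonempty with hCe | hCn
    · refine ⟨1 / 4, by norm_num, by norm_num, fun z hz => hout _ (by norm_num) z hz ?_⟩
      simp [hCe]
    obtain ⟨z₁, hz₁, hmin⟩ := hC.exists_isMinOn hCn (f := fun z => F z - binaryForm a b c z)
      (by fun_prop)
    obtain ⟨z₂, hz₂, hmax₂⟩ := hC.exists_isMaxOn hCn hqc.continuousOn
    have hδ : 0 < F z₁ - binaryForm a b c z₁ := by
      have hz₁0 : z₁ ≠ 0 := Metric.ne_of_mem_sphere hz₁.1 one_ne_zero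
      refine sub_pos.2 ((h1 z₁).lt_of_ne (hne z₁ fun hw => ?_))
      have e1 := hlag z₁
      have e2 : 3 * l z₁ ^ 2 ≤ 2 * binaryForm a b c z₁ := hz₁.2
      rw [hw] at e1
      nlinarith [binaryForm_pos hD h0 hz₁0]
    set δ := F z₁ - binaryForm a b c z₁ with hδdef
    set M := binaryForm a b c z₂ with hM
    have hM0 : 0 ≤ M := h0 z₂
    refine ⟨min (1 / 4) (δ / (2 * M + 1)), by positivity,
      lt_of_le_of_lt (min_le_left _ _) (by norm_num), fun z hz => ?_⟩
    by_cases hzC : z ∈ C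
    · have e1 : δ ≤ F z - binaryForm a b c z := hmin hzC
      have e2 : binaryForm a b c z ≤ M := hmax₂ hzC
      have e3 : min (1 / 4) (δ / (2 * M + 1)) * (2 * binaryForm a b c z - 3 * l z ^ 2) ≤
          δ / (2 * M + 1) * (2 * M + 1) :=
        mul_le_mul (min_le_right _ _) (by nlinarith [sq_nonneg (l z)])
          (sub_nonneg.2 hzC.2) (by positivity)
      rw [div_mul_cancel₀ _ (by positivity)] at e3
      linarith
    · exact hout _ (by positivity) z hz hzC
  set A := a * u.1 + b * u.2 with hA
  set B := b * u.1 + c * u.2 with hB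
  have hform : ∀ z, binaryForm (a + ε * (2 * a - 3 * A ^ 2)) (b + ε * (2 * b - 3 * (A * B)))
      (c + ε * (2 * c - 3 * B ^ 2)) z =
      binaryForm a b c z + ε * (2 * binaryForm a b c z - 3 * l z ^ 2) := by
    intro z; simp only [binaryForm, hl]; ring
  have hle := hmax (a + ε * (2 * a - 3 * A ^ 2)) (b + ε * (2 * b - 3 * (A * B)))
      (c + ε * (2 * c - 3 * B ^ 2))
      (fun z => by
        rw [hform, hlag z]
        have : 0 ≤ (a * c - b ^ 2) * (u.1 * z.2 - u.2 * z.1) ^ 2 := by positivity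
        nlinarith [sq_nonneg (l z)])
      (le_of_le_on_sphere hF (binaryForm_smul _ _ _) fun z hz => by rw [hform]; exact hεF z hz)
  have hdet : (a + ε * (2 * a - 3 * A ^ 2)) * (c + ε * (2 * c - 3 * B ^ 2)) -
      (b + ε * (2 * b - 3 * (A * B))) ^ 2 = (a * c - b ^ 2) * ((1 + 2 * ε) * (1 - ε)) := by
    have : a * B ^ 2 + c * A ^ 2 - 2 * b * (A * B) = a * c - b ^ 2 := by
      have h : a * B ^ 2 + c * A ^ 2 - 2 * b * (A * B) =
          (a * c - b ^ 2) * binaryForm a b c u := by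
        simp only [binaryForm, hA, hB]; ring
      rw [h, hu1, mul_one]
    linear_combination (-3 * ε * (1 + 2 * ε)) * this
  rw [hdet] at hle
  have : 0 < (a * c - b ^ 2) * (ε * (1 - 2 * ε)) :=
    mul_pos hD (mul_pos hε (by linarith))
  nlinarith

/-- A closed subset of the line that meets every open gap between its points is
order-connected. -/
lemma mem_of_exists_between {T : Set ℝ} (hT : IsClosed T)
    (hmid : ∀ α ∈ T, ∀ β ∈ T, α < β → ∃ γ ∈ T, α < γ ∧ γ < β)
    {a b t : ℝ} (ha : a ∈ T) (hb : b ∈ T) (hat : a ≤ t) (htb : t ≤ b) : t ∈ T := by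
  by_contra ht
  have hA : IsCompact (T ∩ Set.Icc a t) := isCompact_Icc.inter_left hT
  have hB : IsCompact (T ∩ Set.Icc t b) := isCompact_Icc.inter_left hT
  obtain ⟨α, hα⟩ := hA.exists_isGreatest ⟨a, ha, le_rfl, hat⟩
  obtain ⟨β, hβ⟩ := hB.exists_isLeast ⟨b, hb, htb, le_rfl⟩
  have hαt : α < t := hα.1.2.2.lt_of_ne fun h => ht (h ▸ hα.1.1)
  have htβ : t < β := hβ.1.2.1.lt_of_ne fun h => ht (h ▸ hβ.1.1)
  obtain ⟨γ, hγ, h1, h2⟩ := hmid α hα.1.1 β hβ.1.1 (hαt.trans htβ)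
  rcases le_total γ t with h | h
  · exact h1.not_ge (hα.2 ⟨hγ, hα.1.2.1.trans h1.le, h⟩)
  · exact h2.not_ge (hβ.2 ⟨hγ, h, h2.le.trans hβ.1.2.2⟩)

/-- If a form below `F` touches `F` at two independent vectors and `F` satisfies the rhombus
inequality, then it touches `F` at every nonnegative combination of them. -/
lemma touching_of_nonneg_combination {F : ℝ × ℝ → ℝ} (hc : Continuous F)
    (hF : ∀ (r : ℝ) z, F (r • z) = r ^ 2 * F z)
    (hrh : ∀ u v, F u = F v → F (u + v) + F (u - v) ≤ 4 * F u)
    {a b c : ℝ} (hD : 0 < a * c - b ^ 2)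
    (h0 : ∀ z, 0 ≤ binaryForm a b c z) (h1 : ∀ z, binaryForm a b c z ≤ F z)
    {u v : ℝ × ℝ} (huv : u.1 * v.2 - u.2 * v.1 ≠ 0)
    (hu : binaryForm a b c u = F u) (hv : binaryForm a b c v = F v)
    {s t : ℝ} (hs : 0 ≤ s) (ht : 0 ≤ t) :
    binaryForm a b c (s • u + t • v) = F (s • u + t • v) := by
  have hsmul : ∀ (r : ℝ) z, binaryForm a b c z = F z → binaryForm a b c (r • z) = F (r • z) := by
    intro r z h; rw [binaryForm_smul, hF, h]
  have hsum : ∀ x y, binaryForm a b c x = F x → binaryForm a b c y = F y →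
      binaryForm a b c x = binaryForm a b c y → binaryForm a b c (x + y) = F (x + y) := by
    intro x y hx hy hxy
    have e1 := hrh x y (by rw [← hx, ← hy, hxy])
    have e2 := binaryForm_add_add_sub a b c x y
    linarith [h1 (x + y), h1 (x - y)]
  have hqc := continuous_binaryForm a b c
  let g : ℝ → ℝ × ℝ := fun r => (1 - r) • u + r • v
  have hgc : Continuous g := by fun_prop
  have hg0 : ∀ r, g r ≠ 0 := by
    intro r h
    have e1 : (1 - r) * u.1 + r * v.1 = 0 := by simpa [g] using congrArg Prod.fst h
    have e2 : (1 - r) * u.2 + r * v.2 = 0 := by simpa [g] using congrArg Prod.snd h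
    have e3 : r * (u.1 * v.2 - u.2 * v.1) = 0 := by linear_combination u.1 * e2 - u.2 * e1
    have e4 : (1 - r) * (u.1 * v.2 - u.2 * v.1) = 0 := by
      linear_combination v.2 * e1 - v.1 * e2
    have e5 := (mul_eq_zero.1 e3).resolve_right huv
    have e6 := (mul_eq_zero.1 e4).resolve_right huv
    linarith
  let T : Set ℝ := {r | binaryForm a b c (g r) = F (g r)}
  have hT : IsClosed T := isClosed_eq (by fun_prop) (by fun_prop)
  have hmid : ∀ α ∈ T, ∀ β ∈ T, α < β → ∃ γ ∈ T, α < γ ∧ γ < β := by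
    intro α hα β hβ hαβ
    have hqα := binaryForm_pos hD h0 (hg0 α)
    have hqβ := binaryForm_pos hD h0 (hg0 β)
    set p := (√(binaryForm a b c (g α)))⁻¹ with hp
    set r := (√(binaryForm a b c (g β)))⁻¹ with hr
    have hp0 : 0 < p := inv_pos.2 (Real.sqrt_pos.2 hqα)
    have hr0 : 0 < r := inv_pos.2 (Real.sqrt_pos.2 hqβ)
    have hpr : 0 < p + r := add_pos hp0 hr0
    have key := hsum (p • g α) (r • g β) (hsmul _ _ hα) (hsmul _ _ hβ) (by
      rw [binaryForm_smul, binaryForm_smul, hp, hr, inv_pow, inv_pow, Real.sq_sqrt hqα.le,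
        Real.sq_sqrt hqβ.le, inv_mul_cancel₀ hqα.ne', inv_mul_cancel₀ hqβ.ne'])
    refine ⟨(p * α + r * β) / (p + r), ?_, ?_, ?_⟩
    · have e : g ((p * α + r * β) / (p + r)) = (p + r)⁻¹ • (p • g α + r • g β) := by
        ext <;> simp [g] <;> field_simp <;> ring
      show binaryForm a b c (g _) = F (g _)
      rw [e]
      exact hsmul _ _ key
    · rw [lt_div_iff₀ hpr]; nlinarith
    · rw [div_lt_iff₀ hpr]; nlinarith
  rcases (add_nonneg hs ht).eq_or_lt with h | h
  · have hs0 : s = 0 := by linarith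
    have ht0 : t = 0 := by linarith
    simpa [hs0, ht0] using hsmul 0 u hu
  · have hmem : t / (s + t) ∈ T := by
      refine mem_of_exists_between hT hmid (a := 0) (b := 1) ?_ ?_ (by positivity) ?_
      · simpa [T, g] using hu
      · simpa [T, g] using hv
      · rw [div_le_one h]; linarith
    have e : s • u + t • v = (s + t) • g (t / (s + t)) := by
      ext <;> simp [g] <;> field_simp <;> ring
    rw [e]
    exact hsmul _ _ hmem

/-- Day's theorem in the plane: a positive function, homogeneous of degree two, satisfying the
rhombus inequality is a quadratic form. -/
lemma exists_eq_binaryForm_of_rhombus {F : ℝ × ℝ → ℝ} (hc : Continuous F)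
    (hF : ∀ (r : ℝ) z, F (r • z) = r ^ 2 * F z) (hpos : ∀ z ≠ 0, 0 < F z)
    (hrh : ∀ u v, F u = F v → F (u + v) + F (u - v) ≤ 4 * F u) :
    ∃ a b c : ℝ, F = binaryForm a b c := by
  obtain ⟨a, b, c, hD, h0, h1, hmax⟩ := exists_maximal_binaryForm hc hF hpos
  obtain ⟨u, huw, hu⟩ := exists_touching_off_line hc hF hD h0 h1 hmax
    (u := (1, 0)) (by simp)
  have hu0 : u ≠ 0 := by rintro rfl; simp at huw
  obtain ⟨v, huv, hv⟩ := exists_touching_off_line hc hF hD h0 h1 hmax hu0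
  have hneg : ∀ z, binaryForm a b c (-z) = binaryForm a b c z ∧ F (-z) = F z := by
    intro z
    constructor
    · simpa using binaryForm_smul a b c (-1) z
    · simpa using hF (-1) z
  have hcomb : ∀ s t : ℝ, 0 ≤ s →
      binaryForm a b c (s • u + t • v) = F (s • u + t • v) := by
    intro s t hs
    rcases le_total 0 t with ht | ht
    · exact touching_of_nonneg_combination hc hF hrh hD h0 h1 huv hu hv hs ht
    · have huv' : u.1 * (-v).2 - u.2 * (-v).1 ≠ 0 := fun h => huv (by
        simp only [Prod.fst_neg, Prod.snd_neg] at h; linarith)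
      have := touching_of_nonneg_combination hc hF hrh hD h0 h1 huv' hu
        (by rw [(hneg v).1, (hneg v).2, hv]) hs (neg_nonneg.2 ht)
      simpa using this
  refine ⟨a, b, c, funext fun z => ?_⟩
  obtain ⟨s, t, rfl⟩ : ∃ s t : ℝ, z = s • u + t • v := by
    refine ⟨(z.1 * v.2 - z.2 * v.1) / (u.1 * v.2 - u.2 * v.1),
      (u.1 * z.2 - u.2 * z.1) / (u.1 * v.2 - u.2 * v.1), ?_⟩
    refine Prod.ext ?_ ?_ <;>
      simp only [Prod.fst_add, Prod.snd_add, Prod.smul_fst, Prod.smul_snd, smul_eq_mul] <;>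
      rw [div_mul_eq_mul_div, div_mul_eq_mul_div, ← add_div, eq_div_iff huv] <;> ring
  rcases le_total 0 s with hs | hs
  · exact (hcomb s t hs).symm
  · have := hcomb (-s) (-t) (neg_nonneg.2 hs)
    have e : (-s) • u + (-t) • v = -(s • u + t • v) := by module
    rw [e, (hneg _).1, (hneg _).2] at this
    exact this.symm

/-- Day's theorem: the rhombus inequality implies the parallelogram law. -/
lemma parallelogram_of_rhombus {X : Type*} [NormedAddCommGroup X] [NormedSpace ℝ X]
    (h : ∀ u v : X, ‖u‖ = ‖v‖ → ‖u + v‖ ^ 2 + ‖u - v‖ ^ 2 ≤ 4 * ‖u‖ ^ 2) (x y : X) :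
    ‖x + y‖ ^ 2 + ‖x - y‖ ^ 2 = 2 * ‖x‖ ^ 2 + 2 * ‖y‖ ^ 2 := by
  by_cases hxy : LinearIndependent ℝ ![x, y]
  · rw [LinearIndependent.pair_iff] at hxy
    obtain ⟨a, b, c, hF⟩ := exists_eq_binaryForm_of_rhombus
      (F := fun z : ℝ × ℝ => ‖z.1 • x + z.2 • y‖ ^ 2) (by fun_prop)
      (fun r z => by
        have : (r • z).1 • x + (r • z).2 • y = r • (z.1 • x + z.2 • y) := by
          simp only [Prod.smul_fst, Prod.smul_snd, smul_eq_mul]; module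
        simp only [this, norm_smul, mul_pow, Real.norm_eq_abs, sq_abs])
      (fun z hz => by
        have : z.1 • x + z.2 • y ≠ 0 := fun h =>
          hz (Prod.ext (hxy _ _ h).1 (hxy _ _ h).2)
        positivity)
      (fun u v huv => by
        have e1 : (u + v).1 • x + (u + v).2 • y =
            (u.1 • x + u.2 • y) + (v.1 • x + v.2 • y) := by
          simp only [Prod.fst_add, Prod.snd_add]; module
        have e2 : (u - v).1 • x + (u - v).2 • y =
            (u.1 • x + u.2 • y) - (v.1 • x + v.2 • y) := by
          simp only [Prod.fst_sub, Prod.snd_sub]; module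
        simp only [e1, e2]
        exact h _ _ ((sq_eq_sq₀ (norm_nonneg _) (norm_nonneg _)).1 huv))
    have e1 := congrFun hF (1, 1)
    have e2 := congrFun hF (1, -1)
    have e3 := congrFun hF (1, 0)
    have e4 := congrFun hF (0, 1)
    simp [binaryForm, ← sub_eq_add_neg] at e1 e2 e3 e4
    rw [e1, e2, e3, e4]; ring
  · obtain ⟨w, p, q, rfl, rfl⟩ : ∃ (w : X) (p q : ℝ), x = p • w ∧ y = q • w := by
      by_cases hx : x = 0
      · exact ⟨y, 0, 1, by simp [hx], by simp⟩
      · rw [LinearIndependent.pair_iff' hx] at hxy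
        push Not at hxy
        obtain ⟨q, hq⟩ := hxy
        exact ⟨x, 1, q, by simp, hq.symm⟩
    rw [← add_smul, ← sub_smul]
    simp only [norm_smul, mul_pow, Real.norm_eq_abs, sq_abs]
    ring

lemma IsoOrth.norm_le_norm_add {X : Type*} [NormedAddCommGroup X] [NormedSpace ℝ X] {x y : X}
    (h : IsoOrth x y) : ‖x‖ ≤ ‖x + y‖ ∧ ‖y‖ ≤ ‖x + y‖ := by
  unfold IsoOrth at h
  have e1 : ‖(2 : ℝ) • x‖ ≤ ‖x + y‖ + ‖x - y‖ := by
    rw [show (2 : ℝ) • x = (x + y) + (x - y) by module]; exact norm_add_le _ _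
  have e2 : ‖(2 : ℝ) • y‖ ≤ ‖x + y‖ + ‖x - y‖ := by
    rw [show (2 : ℝ) • y = (x + y) - (x - y) by module]; exact norm_sub_le _ _
  rw [norm_smul, Real.norm_two] at e1 e2
  constructor <;> linarith

lemma IsoOrth.norm_add_pos {X : Type*} [NormedAddCommGroup X] [NormedSpace ℝ X] {x y : X}
    (h : IsoOrth x y) (hne : (x, y) ≠ (0, 0)) : 0 < ‖x + y‖ := by
  obtain ⟨h1, h2⟩ := h.norm_le_norm_add
  refine (norm_nonneg _).lt_of_ne fun h0 => hne ?_
  rw [← h0] at h1 h2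
  rw [norm_le_zero_iff.1 h1, norm_le_zero_iff.1 h2]

/-- `H̃²(X) = 1` iff `X` is a Hilbert space, i.e. iff the norm
satisfies the parallelogram law. -/
theorem stmt4 (X : Type*) [NormedAddCommGroup X] [NormedSpace ℝ X] [CompleteSpace X]
    [Nontrivial X] :
    HtildeSq X = 1 ↔
      ∀ x y : X, ‖x + y‖ ^ 2 + ‖x - y‖ ^ 2 = 2 * ‖x‖ ^ 2 + 2 * ‖y‖ ^ 2 := by
  constructor
  · intro hH
    have hbdd : BddAbove {r : ℝ | ∃ x y : X, (x, y) ≠ (0, 0) ∧ IsoOrth x y ∧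
        r = (‖x‖ ^ 2 + ‖y‖ ^ 2) / ‖x + y‖ ^ 2} := by
      refine ⟨2, ?_⟩
      rintro r ⟨x, y, hne, hxy, rfl⟩
      have hp := hxy.norm_add_pos hne
      obtain ⟨h1, h2⟩ := hxy.norm_le_norm_add
      rw [div_le_iff₀ (by positivity)]
      nlinarith [norm_nonneg x, norm_nonneg y]
    refine parallelogram_of_rhombus fun u v huv => ?_
    by_cases hne : (u + v, u - v) = (0, 0)
    · rw [Prod.mk.injEq] at hne
      rw [hne.1, hne.2]
      simp
    have eu : (u + v) + (u - v) = (2 : ℝ) • u := by module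
    have ev : (u + v) - (u - v) = (2 : ℝ) • v := by module
    have hiso : IsoOrth (u + v) (u - v) := by
      unfold IsoOrth
      rw [eu, ev, norm_smul, norm_smul, huv]
    have hp := hiso.norm_add_pos hne
    have hle : (‖u + v‖ ^ 2 + ‖u - v‖ ^ 2) / ‖(u + v) + (u - v)‖ ^ 2 ≤ 1 := by
      rw [← hH]
      exact le_csSup hbdd ⟨_, _, hne, hiso, rfl⟩
    rw [div_le_one (by positivity), eu, norm_smul, Real.norm_two] at hle
    linarith
  · intro h
    have hset : {r : ℝ | ∃ x y : X, (x, y) ≠ (0, 0) ∧ IsoOrth x y ∧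
        r = (‖x‖ ^ 2 + ‖y‖ ^ 2) / ‖x + y‖ ^ 2} = {1} := by
      ext r
      constructor
      · rintro ⟨x, y, hne, hxy, rfl⟩
        have hp := hxy.norm_add_pos hne
        have e := h x y
        unfold IsoOrth at hxy
        rw [← hxy] at e
        rw [Set.mem_singleton_iff, div_eq_one_iff_eq (by positivity)]
        linarith
      · rintro rfl
        obtain ⟨x, hx⟩ := exists_ne (0 : X)
        have hn : ‖x‖ ≠ 0 := norm_ne_zero_iff.2 hx
        exact ⟨x, 0, by simp [hx], by simp [IsoOrth], by simp [hn]⟩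
    rw [HtildeSq, hset, csSup_singleton]
end

section
/- Let X be a nontrivial real Banach space. Then H̃²(X) ≤ C_NJ(X). -/
/-- In any seminormed group, `‖x + y‖² + ‖x - y‖² ≤ 2 (2 ‖x‖² + 2 ‖y‖²)`. -/
theorem norm_add_sq_add_norm_sub_sq_le {E : Type*} [SeminormedAddCommGroup E] (x y : E) :
    ‖x + y‖ ^ 2 + ‖x - y‖ ^ 2 ≤ 2 * (2 * ‖x‖ ^ 2 + 2 * ‖y‖ ^ 2) := by
  have hadd : ‖x + y‖ ^ 2 ≤ (‖x‖ + ‖y‖) ^ 2 := by gcongr; exact norm_add_le x y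
  have hsub : ‖x - y‖ ^ 2 ≤ (‖x‖ + ‖y‖) ^ 2 := by gcongr; exact norm_sub_le x y
  nlinarith [sq_nonneg (‖x‖ - ‖y‖)]

/-- `H̃²(X) ≤ C_NJ(X)` for a nontrivial real Banach space `X`. -/
theorem stmt5 (X : Type*) [NormedAddCommGroup X] [NormedSpace ℝ X] [CompleteSpace X]
    [Nontrivial X] :
    HtildeSq X ≤ CNJ X := by
  refine csSup_le_csSup ?_ ?_ ?_
  · refine ⟨2, ?_⟩
    rintro r ⟨x, y, -, rfl⟩
    exact div_le_of_le_mul₀ (by positivity) (by norm_num) (norm_add_sq_add_norm_sub_sq_le x y)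
  · obtain ⟨x, hx⟩ := exists_ne (0 : X)
    exact ⟨_, x, 0, by simp [hx], by simp [IsoOrth], rfl⟩
  · rintro r ⟨x, y, hxy, horth, rfl⟩
    have hx : (x + y) + (x - y) = (2 : ℝ) • x := by module
    have hy : (x + y) - (x - y) = (2 : ℝ) • y := by module
    refine ⟨x + y, x - y, fun h => hxy ?_, ?_⟩
    · obtain ⟨h₁, h₂⟩ := Prod.mk.inj h
      rw [h₁, h₂, add_zero] at hx
      rw [h₁, h₂, sub_zero] at hy
      simpa using And.intro hx.symm hy.symm
    · unfold IsoOrth at horth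
      rw [hx, hy, ← horth, norm_smul, norm_smul, Real.norm_two, mul_pow, mul_pow, ← mul_add,
        ← add_mul, show (2 : ℝ) + 2 = 2 ^ 2 by norm_num]
      exact (mul_div_mul_left _ _ (by norm_num)).symm
end

section
/- Let X be a nontrivial real Banach space. Then J(X)²/2 ≤ H̃²(X) ≤ J(X). -/
section

variable {X : Type*} [NormedAddCommGroup X]

lemma IsoOrth.symm {x y : X} (h : IsoOrth x y) : IsoOrth y x := by
  unfold IsoOrth at *
  rw [add_comm, h, norm_sub_rev]

lemma le_jamesConst {x y : X} (hx : ‖x‖ ≤ 1) (hy : ‖y‖ ≤ 1) (h : IsoOrth x y) :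
    ‖x + y‖ ≤ JamesConst X := by
  refine le_csSup ⟨2, ?_⟩ ⟨x, y, hx, hy, h, rfl⟩
  rintro r ⟨x, y, hx, hy, -, rfl⟩
  linarith [norm_add_le x y]

variable [NormedSpace ℝ X]

lemma IsoOrth.norm_le_add {x y : X} (h : IsoOrth x y) : ‖x‖ ≤ ‖x + y‖ := by
  have h₁ : ‖(x + y) + (x - y)‖ ≤ ‖x + y‖ + ‖x - y‖ := norm_add_le _ _
  have h₂ : (x + y) + (x - y) = (2 : ℝ) • x := by module
  rw [h₂, norm_smul, ← h] at h₁
  norm_num at h₁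
  linarith

lemma le_htildeSq {x y : X} (h₀ : (x, y) ≠ (0, 0)) (h : IsoOrth x y) :
    (‖x‖ ^ 2 + ‖y‖ ^ 2) / ‖x + y‖ ^ 2 ≤ HtildeSq X := by
  refine le_csSup ⟨2, ?_⟩ ⟨x, y, h₀, h, rfl⟩
  rintro r ⟨x, y, -, h, rfl⟩
  have hx := h.norm_le_add
  have hy := h.symm.norm_le_add
  rw [add_comm] at hy
  refine div_le_of_le_mul₀ (by positivity) (by norm_num) ?_
  nlinarith [norm_nonneg x, norm_nonneg y]

lemma one_le_jamesConst [Nontrivial X] : 1 ≤ JamesConst X := by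
  obtain ⟨e, he⟩ := exists_norm_eq X zero_le_one
  have := le_jamesConst (x := e) (y := 0) he.le (by simp) (by simp [IsoOrth])
  simpa [he] using this

lemma apply_le_norm_of_norm_le_one {g : StrongDual ℝ X} (hg : ‖g‖ ≤ 1) (x : X) : g x ≤ ‖x‖ :=
  (le_abs_self _).trans (by simpa using g.le_of_opNorm_le hg x)

/-- Deforming `x` into `-y` along a segment reaches a vector isosceles orthogonal to `y`. -/
lemma le_jamesConst_of_functional {x y : X} (hx : ‖x‖ ≤ 1) (hy : ‖y‖ ≤ 1)
    (h : ‖x - y‖ ≤ ‖x + y‖) {k : StrongDual ℝ X} (hk : ‖k‖ ≤ 1)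
    (hxy : k (x - y) = ‖x - y‖) (hky : ‖x - y‖ ≤ -2 * k y) : ‖x - y‖ ≤ JamesConst X := by
  let z : ℝ → X := fun t ↦ (1 - t) • x - t • y
  have hz : Continuous z := by fun_prop
  obtain ⟨t, ⟨ht₀, ht₁⟩, ht⟩ : (0 : ℝ) ∈ (fun t ↦ ‖z t + y‖ - ‖z t - y‖) '' Set.Icc 0 1 :=
    intermediate_value_Icc' zero_le_one (by fun_prop) (by simpa [z] using h)
  have hiso : IsoOrth (z t) y := sub_eq_zero.mp ht
  have hzt : ‖z t‖ ≤ 1 := by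
    calc ‖z t‖ ≤ ‖(1 - t) • x‖ + ‖t • y‖ := norm_sub_le _ _
      _ = (1 - t) * ‖x‖ + t * ‖y‖ := by
        rw [norm_smul, norm_smul, Real.norm_of_nonneg ht₀, Real.norm_of_nonneg (by linarith)]
      _ ≤ 1 := by nlinarith
  refine le_trans ?_ (le_jamesConst hzt hy hiso)
  rw [hiso]
  refine le_trans ?_ (apply_le_norm_of_norm_le_one hk _)
  have hval : k (z t - y) = (1 - t) * k (x - y) + t * (-2 * k y) := by
    simp only [z, map_sub, map_smul, smul_eq_mul]
    ring
  rw [hval, hxy]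
  nlinarith

lemma min_norm_le_jamesConst {x y : X} (hx : ‖x‖ ≤ 1) (hy : ‖y‖ ≤ 1) :
    min ‖x + y‖ ‖x - y‖ ≤ JamesConst X := by
  wlog h : ‖x - y‖ ≤ ‖x + y‖ generalizing y
  · simpa [← sub_eq_add_neg, min_comm] using
      this (y := -y) (by simpa using hy) (by simpa [← sub_eq_add_neg] using (not_le.mp h).le)
  rw [min_eq_right h]
  obtain ⟨k, hk, hxy⟩ := exists_dual_vector'' ℝ (x - y)
  replace hxy : k (x - y) = ‖x - y‖ := by simpa using hxy
  have hsplit : k x - k y = ‖x - y‖ := by rw [← map_sub, hxy]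
  rcases le_total (‖x - y‖) (-2 * k y) with hky | hky
  · exact le_jamesConst_of_functional hx hy h hk hxy hky
  · have hrev : -y - -x = x - y := by abel
    have hadd : ‖-y + -x‖ = ‖x + y‖ := by rw [← neg_add_rev, norm_neg]
    have := le_jamesConst_of_functional (x := -y) (y := -x) (by simpa using hy)
      (by simpa using hx) (by rwa [hrev, hadd]) hk (by rwa [hrev])
      (by rw [hrev, map_neg]; linarith)
    rwa [hrev] at this

lemma sq_add_sq_mul_le {a b : ℝ} (hb : 0 < b) (hba : b ≤ a) (ha : a ≤ 2)
    (h : 4 ≤ a ^ 2 + b ^ 2) :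
    (a ^ 2 + b ^ 2) * (4 - 2 * a + 2 * a * b - b ^ 2) ≤ 4 * b * (4 - 2 * b + a * b) := by
  obtain ⟨d, rfl⟩ : ∃ d, a = 2 - d := ⟨2 - a, by ring⟩
  have hd : 0 ≤ d := by linarith
  have hbd : 0 ≤ 2 - d - b := by linarith
  have hsq : 0 ≤ b ^ 2 - 4 * d + d ^ 2 := by nlinarith
  nlinarith [mul_nonneg hd hbd, mul_nonneg hsq hb.le, mul_nonneg hsq hd, mul_nonneg hsq hbd,
    sq_nonneg (b * (2 - b)), mul_nonneg (mul_nonneg hd hbd) hb.le,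
    mul_nonneg (mul_nonneg hd hd) hbd, mul_nonneg (mul_nonneg hd hb.le) (mul_nonneg hb.le hbd),
    mul_nonneg hsq (mul_nonneg hb.le hbd), mul_nonneg hsq (mul_nonneg hb.le hd),
    mul_nonneg hsq (mul_nonneg hb.le hb.le)]

lemma sq_add_sq_le_jamesConst_of_functional {p q : X} (hp : ‖p‖ = 1) (hq : ‖q‖ = 1)
    (hb : 0 < ‖p - q‖) (hba : ‖p - q‖ ≤ ‖p + q‖) (h : 4 ≤ ‖p + q‖ ^ 2 + ‖p - q‖ ^ 2)
    {g : StrongDual ℝ X} (hg : ‖g‖ ≤ 1) (hgb : g (p - q) = ‖p - q‖) (hgpq : 0 ≤ g (p + q)) :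
    (‖p + q‖ ^ 2 + ‖p - q‖ ^ 2) / 4 ≤ JamesConst X := by
  obtain ⟨f, hf, hfa⟩ := exists_dual_vector'' ℝ (p + q)
  replace hfa : f (p + q) = ‖p + q‖ := by simpa using hfa
  have ha : ‖p + q‖ ≤ 2 := by linarith [norm_add_le p q]
  have hfp := apply_le_norm_of_norm_le_one hf p
  set a := ‖p + q‖
  set b := ‖p - q‖ with hb_def
  have hfpq : f (p - q) ≤ 2 - a := by
    rw [map_add] at hfa
    rw [map_sub]
    linarith
  set D := 4 - 2 * a + 2 * a * b - b ^ 2 with hD_def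
  have hD : 0 < D := by nlinarith [mul_pos hb hb]
  set s := 2 * b * (a - b) / D with hs_def
  have hs₀ : 0 ≤ s := div_nonneg (mul_nonneg (by positivity) (by linarith)) hD.le
  have hs₁ : s ≤ 1 := by
    rw [hs_def, div_le_one hD]
    nlinarith
  have hsD : s * D = 2 * b * (a - b) := div_mul_cancel₀ _ hD.ne'
  have hb2 : b ≤ 2 := hba.trans ha
  let y : X := (1 - s) • q - (s / b) • (p - q)
  have hy : ‖y‖ ≤ 1 := by
    calc ‖y‖ ≤ ‖(1 - s) • q‖ + ‖(s / b) • (p - q)‖ := norm_sub_le _ _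
      _ = 1 := by
        rw [norm_smul, norm_smul, hq, ← hb_def, Real.norm_of_nonneg (by linarith),
          Real.norm_of_nonneg (by positivity)]
        field_simp
        ring
  have hV : (a ^ 2 + b ^ 2) / 4 ≤ b + s * (2 - b) / 2 := by
    have hDs : D * (b + s * (2 - b) / 2) = b * (4 - 2 * b + a * b) := by
      linear_combination (2 - b) / 2 * hsD
    have := sq_add_sq_mul_le hb hba ha h
    refine le_of_mul_le_mul_left ?_ hD
    rw [hDs]
    linarith
  have hadd : b + s * (2 - b) / 2 ≤ ‖p + y‖ := by
    refine le_trans ?_ (apply_le_norm_of_norm_le_one hf _)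
    have hval : f (p + y) = (1 - s / 2) * f (p + q) - s * (2 - b) / (2 * b) * f (p - q) := by
      simp only [y, map_add, map_sub, map_smul, smul_eq_mul]
      field_simp
      ring
    have hbal : b + s * (2 - b) / 2 = (1 - s / 2) * a - s * (2 - b) / (2 * b) * (2 - a) := by
      field_simp
      linear_combination hsD
    rw [hval, hfa, hbal]
    have : 0 ≤ s * (2 - b) / (2 * b) :=
      div_nonneg (mul_nonneg hs₀ (by linarith)) (by positivity)
    gcongr
  have hsub : b + s * (2 - b) / 2 ≤ ‖p - y‖ := by
    refine le_trans ?_ (apply_le_norm_of_norm_le_one hg _)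
    have hval : g (p - y) = (1 + s / b - s / 2) * g (p - q) + s / 2 * g (p + q) := by
      simp only [y, map_add, map_sub, map_smul, smul_eq_mul]
      ring
    have hbal : (1 + s / b - s / 2) * b = b + s * (2 - b) / 2 := by
      field_simp
      ring
    rw [hval, hgb, hbal]
    exact le_add_of_nonneg_right (by positivity)
  exact hV.trans ((le_min hadd hsub).trans (min_norm_le_jamesConst hp.le hy))

lemma sq_add_sq_le_jamesConst [Nontrivial X] {p q : X} (hp : ‖p‖ = 1) (hq : ‖q‖ = 1) :
    (‖p + q‖ ^ 2 + ‖p - q‖ ^ 2) / 4 ≤ JamesConst X := by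
  wlog hba : ‖p - q‖ ≤ ‖p + q‖ generalizing q
  · simpa [← sub_eq_add_neg, add_comm] using
      this (q := -q) (by simpa using hq) (by simpa [← sub_eq_add_neg] using (not_le.mp hba).le)
  rcases le_total (‖p + q‖ ^ 2 + ‖p - q‖ ^ 2) 4 with h | h
  · linarith [one_le_jamesConst (X := X)]
  rcases (norm_nonneg (p - q)).eq_or_lt with hb | hb
  · have ha : ‖p + q‖ ≤ 2 := by linarith [norm_add_le p q]
    rw [← hb]
    nlinarith [one_le_jamesConst (X := X), norm_nonneg (p + q)]
  obtain ⟨g, hg, hgb⟩ := exists_dual_vector'' ℝ (p - q)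
  replace hgb : g (p - q) = ‖p - q‖ := by simpa using hgb
  rcases le_total 0 (g (p + q)) with hs | hs
  · exact sq_add_sq_le_jamesConst_of_functional hp hq hb hba h hg hgb hs
  · have := sq_add_sq_le_jamesConst_of_functional (p := q) (q := p) (g := -g) hq hp
      (by rwa [norm_sub_rev]) (by rwa [norm_sub_rev, add_comm])
      (by rwa [norm_sub_rev, add_comm q]) (by rwa [norm_neg])
      (by rw [norm_sub_rev, ← hgb, ← neg_sub p q]; simp) (by rw [add_comm, neg_apply]; linarith)
    rwa [norm_sub_rev, add_comm q] at this

lemma htildeSq_le_jamesConst [Nontrivial X] : HtildeSq X ≤ JamesConst X := by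
  have hJ := one_le_jamesConst (X := X)
  refine Real.sSup_le ?_ (by linarith)
  rintro r ⟨x, y, -, h, rfl⟩
  rcases (norm_nonneg (x + y)).eq_or_lt with hn | hn
  · rw [← hn]
    simp
    linarith
  set n := ‖x + y‖ with hn_def
  have hp : ‖n⁻¹ • (x + y)‖ = 1 := by
    rw [norm_smul, ← hn_def, norm_inv, Real.norm_of_nonneg hn.le, inv_mul_cancel₀ hn.ne']
  have hq : ‖n⁻¹ • (x - y)‖ = 1 := by
    rw [norm_smul, ← h, ← hn_def, norm_inv, Real.norm_of_nonneg hn.le, inv_mul_cancel₀ hn.ne']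
  have hadd : n⁻¹ • (x + y) + n⁻¹ • (x - y) = (2 * n⁻¹) • x := by module
  have hsub : n⁻¹ • (x + y) - n⁻¹ • (x - y) = (2 * n⁻¹) • y := by module
  convert sq_add_sq_le_jamesConst hp hq using 1
  rw [hadd, hsub, norm_smul, norm_smul, Real.norm_of_nonneg (by positivity)]
  field_simp
  ring

lemma sq_add_sq_le_htildeSq {p q : X} (hp : ‖p‖ = 1) (hq : ‖q‖ = 1) :
    (‖p + q‖ ^ 2 + ‖p - q‖ ^ 2) / 4 ≤ HtildeSq X := by
  have hadd : (p + q) + (p - q) = (2 : ℝ) • p := by module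
  have hsub : (p + q) - (p - q) = (2 : ℝ) • q := by module
  have h₀ : (p + q, p - q) ≠ (0, 0) := by
    intro h
    obtain ⟨h₁, h₂⟩ := Prod.mk.inj h
    rw [h₁, h₂, add_zero] at hadd
    have := congrArg norm hadd
    simp [norm_smul, hp] at this
  convert le_htildeSq h₀ (by rw [IsoOrth, hadd, hsub, norm_smul, norm_smul, hp, hq]) using 2
  rw [hadd, norm_smul, hp]
  norm_num

/-- The sum `‖x + y‖² + ‖x - y‖²` does not decrease when `x` is pushed to the unit sphere. -/
lemma exists_norm_eq_one_sq_add_sq_le [Nontrivial X] {x : X} (hx : ‖x‖ ≤ 1) (y : X) :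
    ∃ p : X, ‖p‖ = 1 ∧ ‖x + y‖ ^ 2 + ‖x - y‖ ^ 2 ≤ ‖p + y‖ ^ 2 + ‖p - y‖ ^ 2 := by
  obtain ⟨p, hp, hxp⟩ : ∃ p : X, ‖p‖ = 1 ∧ x = ‖x‖ • p := by
    rcases eq_or_ne x 0 with rfl | h₀
    · obtain ⟨e, he⟩ := exists_norm_eq X zero_le_one
      exact ⟨e, he, by simp⟩
    · exact ⟨‖x‖⁻¹ • x, norm_smul_inv_norm h₀, by simp [smul_smul, h₀]⟩
  refine ⟨p, hp, ?_⟩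
  set t := ‖x‖
  have ht : 0 ≤ t := norm_nonneg x
  have hcomb (u v : X) : ‖((1 + t) / 2) • u + ((1 - t) / 2) • v‖ ≤
      (1 + t) / 2 * ‖u‖ + (1 - t) / 2 * ‖v‖ := by
    refine (norm_add_le _ _).trans_eq ?_
    rw [norm_smul, norm_smul, Real.norm_of_nonneg (by linarith), Real.norm_of_nonneg (by linarith)]
  have h₁ : ‖x + y‖ ≤ (1 + t) / 2 * ‖p + y‖ + (1 - t) / 2 * ‖p - y‖ := by
    have := hcomb (p + y) (y - p)
    rw [norm_sub_rev y p] at this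
    convert this using 2
    rw [hxp]
    module
  have h₂ : ‖x - y‖ ≤ (1 + t) / 2 * ‖p - y‖ + (1 - t) / 2 * ‖p + y‖ := by
    have := hcomb (p - y) (-(p + y))
    rw [norm_neg] at this
    convert this using 2
    rw [hxp]
    module
  have h₁' := pow_le_pow_left₀ (norm_nonneg _) h₁ 2
  have h₂' := pow_le_pow_left₀ (norm_nonneg _) h₂ 2
  nlinarith [mul_nonneg (sub_nonneg.mpr (pow_le_one₀ ht hx : t ^ 2 ≤ 1))
    (sq_nonneg (‖p + y‖ - ‖p - y‖))]

lemma sq_div_two_le_htildeSq [Nontrivial X] {x y : X} (hx : ‖x‖ ≤ 1) (hy : ‖y‖ ≤ 1)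
    (h : IsoOrth x y) : ‖x + y‖ ^ 2 / 2 ≤ HtildeSq X := by
  obtain ⟨p, hp, hxp⟩ := exists_norm_eq_one_sq_add_sq_le hx y
  obtain ⟨q, hq, hyq⟩ := exists_norm_eq_one_sq_add_sq_le hy p
  have := sq_add_sq_le_htildeSq hp hq
  rw [← h] at hxp
  rw [add_comm y p, add_comm q p, norm_sub_rev y p, norm_sub_rev q p] at hyq
  linarith

lemma jamesConst_sq_div_two_le_htildeSq [Nontrivial X] :
    JamesConst X ^ 2 / 2 ≤ HtildeSq X := by
  have hH : 0 ≤ HtildeSq X := by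
    refine le_trans ?_ (sq_div_two_le_htildeSq (x := (0 : X)) (y := 0) (by simp) (by simp) (by simp [IsoOrth]))
    positivity
  have hJ : JamesConst X ≤ √(2 * HtildeSq X) := by
    refine Real.sSup_le ?_ (Real.sqrt_nonneg _)
    rintro r ⟨x, y, hx, hy, h, rfl⟩
    exact Real.le_sqrt_of_sq_le (by linarith [sq_div_two_le_htildeSq hx hy h])
  have := pow_le_pow_left₀ (zero_le_one.trans one_le_jamesConst) hJ 2
  rw [Real.sq_sqrt (by positivity)] at this
  linarith

end

/-- `J(X)²/2 ≤ H̃²(X) ≤ J(X)` for a nontrivial real Banach space `X`. -/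
theorem stmt6 (X : Type*) [NormedAddCommGroup X] [NormedSpace ℝ X] [CompleteSpace X]
    [Nontrivial X] :
    JamesConst X ^ 2 / 2 ≤ HtildeSq X ∧ HtildeSq X ≤ JamesConst X := by
  exact ⟨jamesConst_sq_div_two_le_htildeSq, htildeSq_le_jamesConst⟩
end

section
/- Let X be a nontrivial real Banach space and let τ, υ > 0. Then 2(τ²+υ²)/υ² ≤ L^I_YJ(τ, υ, X) ≤ 2(τ+υ)²/υ². -/
/-- Every quotient in the supremum defining `LIYJ X τ υ` is at most `2 (τ + υ)² / υ²`. -/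
theorem IsoOrth.div_le {X : Type*} [NormedAddCommGroup X] [NormedSpace ℝ X] {x y : X}
    (hne : (x, y) ≠ (0, 0)) (h : IsoOrth x y) {τ υ : ℝ} (hτ : 0 < τ) (hυ : 0 < υ) :
    (‖(τ + υ) • x + (υ - τ) • y‖ ^ 2 + ‖(υ - τ) • x - (τ + υ) • y‖ ^ 2) /
      (υ ^ 2 * ‖x + y‖ ^ 2) ≤ 2 * (τ + υ) ^ 2 / υ ^ 2 := by
  have h : ‖x + y‖ = ‖x - y‖ := h
  have hpos : 0 < ‖x + y‖ := by
    refine (norm_nonneg _).lt_of_ne' fun h0 => hne ?_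
    have h1 : x + y = 0 := norm_eq_zero.1 h0
    have h2 : x = y := sub_eq_zero.1 (norm_eq_zero.1 (h ▸ h0))
    subst h2
    simpa [← two_smul ℝ x] using h1
  have e1 : (τ + υ) • x + (υ - τ) • y = υ • (x + y) + τ • (x - y) := by module
  have e2 : (υ - τ) • x - (τ + υ) • y = υ • (x - y) - τ • (x + y) := by module
  have b1 : ‖(τ + υ) • x + (υ - τ) • y‖ ≤ (τ + υ) * ‖x + y‖ := by
    rw [e1]
    refine (norm_add_le _ _).trans_eq ?_
    rw [norm_smul_of_nonneg hυ.le, norm_smul_of_nonneg hτ.le, ← h]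
    ring
  have b2 : ‖(υ - τ) • x - (τ + υ) • y‖ ≤ (τ + υ) * ‖x + y‖ := by
    rw [e2]
    refine (norm_sub_le _ _).trans_eq ?_
    rw [norm_smul_of_nonneg hυ.le, norm_smul_of_nonneg hτ.le, ← h]
    ring
  calc _ ≤ (((τ + υ) * ‖x + y‖) ^ 2 + ((τ + υ) * ‖x + y‖) ^ 2) / (υ ^ 2 * ‖x + y‖ ^ 2) := by
        gcongr
    _ = 2 * (τ + υ) ^ 2 / υ ^ 2 := by
        field_simp
        ring

/-- `2(τ²+υ²)/υ² ≤ L^I_YJ(τ, υ, X) ≤ 2(τ+υ)²/υ²`. -/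
theorem stmt8 (X : Type*) [NormedAddCommGroup X] [NormedSpace ℝ X] [CompleteSpace X]
    [Nontrivial X] (τ υ : ℝ) (hτ : 0 < τ) (hυ : 0 < υ) :
    2 * (τ ^ 2 + υ ^ 2) / υ ^ 2 ≤ LIYJ X τ υ ∧
      LIYJ X τ υ ≤ 2 * (τ + υ) ^ 2 / υ ^ 2 := by
  have hbound : ∀ r ∈ {r : ℝ | ∃ x y : X, (x, y) ≠ (0, 0) ∧ IsoOrth x y ∧
      r = (‖(τ + υ) • x + (υ - τ) • y‖ ^ 2 + ‖(υ - τ) • x - (τ + υ) • y‖ ^ 2) /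
        (υ ^ 2 * ‖x + y‖ ^ 2)}, r ≤ 2 * (τ + υ) ^ 2 / υ ^ 2 := by
    rintro r ⟨x, y, hne, h, rfl⟩
    exact h.div_le hne hτ hυ
  refine ⟨le_csSup ⟨_, hbound⟩ ?_, Real.sSup_le hbound (by positivity)⟩
  obtain ⟨x, hx⟩ := exists_ne (0 : X)
  refine ⟨x, 0, by simp [hx], by simp [IsoOrth], ?_⟩
  have hx' : ‖x‖ ≠ 0 := norm_ne_zero_iff.2 hx
  simp only [smul_zero, add_zero, sub_zero, norm_smul, Real.norm_eq_abs, mul_pow, sq_abs]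
  field_simp
  ring
end

section
/- Let n ≥ 2 and let X = ℝⁿ equipped with the ℓ¹ norm ‖x‖₁ = Σᵢ |xᵢ|. Then for all τ, υ > 0, L^I_YJ(τ, υ, X) = 2(τ+υ)²/υ². -/
/-- The `ℓ¹` norm of a combination of two distinct standard basis vectors. -/
theorem norm_smul_single_add_smul_single {ι : Type*} [Fintype ι] [DecidableEq ι] {i j : ι}
    (hij : i ≠ j) (a b : ℝ) :
    ‖a • PiLp.single 1 (β := fun _ : ι => ℝ) i 1 + b • PiLp.single 1 j 1‖ = |a| + |b| := by
  rw [PiLp.norm_eq_of_L1, Fintype.sum_eq_add i j hij]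
  · simp [hij, hij.symm]
  · rintro k ⟨hki, hkj⟩
    simp [hki, hkj]

/-- Every quotient in the definition of `LIYJ` is at most `2(τ+υ)²/υ²`, in any normed space. -/
theorem IsoOrth.quotient_le {X : Type*} [NormedAddCommGroup X] [NormedSpace ℝ X] {x y : X}
    (h : IsoOrth x y) (h0 : (x, y) ≠ (0, 0)) {τ υ : ℝ} (hτ : 0 < τ) (hυ : 0 < υ) :
    (‖(τ + υ) • x + (υ - τ) • y‖ ^ 2 + ‖(υ - τ) • x - (τ + υ) • y‖ ^ 2) /
      (υ ^ 2 * ‖x + y‖ ^ 2) ≤ 2 * (τ + υ) ^ 2 / υ ^ 2 := by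
  unfold IsoOrth at h
  have hpos : 0 < ‖x + y‖ := by
    refine norm_pos_iff.2 fun hs => h0 ?_
    rw [hs, norm_zero, eq_comm, norm_eq_zero, sub_eq_zero] at h
    subst h
    have hx : x = 0 := by simpa [← two_smul ℝ x] using hs
    simp [hx]
  have h1 : ‖(τ + υ) • x + (υ - τ) • y‖ ≤ (τ + υ) * ‖x + y‖ := by
    calc _ = ‖υ • (x + y) + τ • (x - y)‖ := by congr 1; module
      _ ≤ ‖υ • (x + y)‖ + ‖τ • (x - y)‖ := norm_add_le _ _
      _ = (τ + υ) * ‖x + y‖ := by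
        rw [norm_smul, norm_smul, ← h, Real.norm_of_nonneg hυ.le, Real.norm_of_nonneg hτ.le]
        ring
  have h2 : ‖(υ - τ) • x - (τ + υ) • y‖ ≤ (τ + υ) * ‖x + y‖ := by
    calc _ = ‖υ • (x - y) - τ • (x + y)‖ := by congr 1; module
      _ ≤ ‖υ • (x - y)‖ + ‖τ • (x + y)‖ := norm_sub_le _ _
      _ = (τ + υ) * ‖x + y‖ := by
        rw [norm_smul, norm_smul, ← h, Real.norm_of_nonneg hυ.le, Real.norm_of_nonneg hτ.le]
        ring
  rw [div_le_div_iff₀ (by positivity) (by positivity)]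
  calc _ ≤ (((τ + υ) * ‖x + y‖) ^ 2 + ((τ + υ) * ‖x + y‖) ^ 2) * υ ^ 2 := by gcongr
    _ = _ := by ring

/-- For `X = ℝⁿ` (`n ≥ 2`) with the `ℓ¹` norm,
`L^I_YJ(τ, υ, X) = 2(τ+υ)²/υ²` for all `τ, υ > 0`. -/
theorem stmt9 (n : ℕ) (hn : 2 ≤ n) (τ υ : ℝ) (hτ : 0 < τ) (hυ : 0 < υ) :
    LIYJ (PiLp 1 fun _ : Fin n => ℝ) τ υ = 2 * (τ + υ) ^ 2 / υ ^ 2 := by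
  refine IsGreatest.csSup_eq ⟨?_, ?_⟩
  · have hij : (⟨0, by omega⟩ : Fin n) ≠ ⟨1, by omega⟩ := by simp
    have key := norm_smul_single_add_smul_single hij
    set u : PiLp 1 fun _ : Fin n => ℝ := PiLp.single 1 ⟨0, by omega⟩ 1
    set v : PiLp 1 fun _ : Fin n => ℝ := PiLp.single 1 ⟨1, by omega⟩ 1
    have hadd : (1 / 2 : ℝ) • (u + v) + (1 / 2 : ℝ) • (u - v) = (1 : ℝ) • u + (0 : ℝ) • v := by
      module
    have hsub : (1 / 2 : ℝ) • (u + v) - (1 / 2 : ℝ) • (u - v) = (0 : ℝ) • u + (1 : ℝ) • v := by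
      module
    refine ⟨(1 / 2 : ℝ) • (u + v), (1 / 2 : ℝ) • (u - v), ?_, ?_, ?_⟩
    · intro h
      rw [Prod.mk.injEq] at h
      have h1 := key 1 0
      rw [← hadd, h.1, h.2] at h1
      norm_num at h1
    · rw [IsoOrth, hadd, hsub, key, key, add_comm]
    · have h1 : (τ + υ) • (1 / 2 : ℝ) • (u + v) + (υ - τ) • (1 / 2 : ℝ) • (u - v) =
          υ • u + τ • v := by module
      have h2 : (υ - τ) • (1 / 2 : ℝ) • (u + v) - (τ + υ) • (1 / 2 : ℝ) • (u - v) =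
          (-τ) • u + υ • v := by module
      rw [h1, h2, hadd, key, key, key, abs_neg, abs_of_pos hτ, abs_of_pos hυ]
      norm_num
      ring
  · rintro r ⟨x, y, h0, h, rfl⟩
    exact h.quotient_le h0 hτ hυ
end

section
/- Let X be a nontrivial real Banach space. Then X is a Hilbert space (i.e., its norm is induced by an inner product) if and only if there exist τ₀, υ₀ > 0 such that L^I_YJ(τ₀, υ₀, X) = 2(τ₀²+υ₀²)/υ₀². -/
/-- The binary quadratic form with coefficients `A`, `2 * B`, `C`. -/
def binaryQuad (A B C : ℝ) (z : ℝ × ℝ) : ℝ := A * z.1 ^ 2 + 2 * B * z.1 * z.2 + C * z.2 ^ 2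

lemma continuous_binaryQuad (A B C : ℝ) : Continuous (binaryQuad A B C) := by
  unfold binaryQuad; fun_prop

lemma binaryQuad_smul (A B C c : ℝ) (z : ℝ × ℝ) :
    binaryQuad A B C (c • z) = c ^ 2 * binaryQuad A B C z := by
  simp only [binaryQuad, Prod.smul_fst, Prod.smul_snd, smul_eq_mul]; ring

lemma binaryQuad_pos {A B C : ℝ} (hA : 0 ≤ A) (hD : 0 < A * C - B ^ 2)
    {z : ℝ × ℝ} (hz : z ≠ 0) : 0 < binaryQuad A B C z := by
  have hA' : 0 < A := by
    rcases hA.eq_or_lt with h | h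
    · subst h; nlinarith [sq_nonneg B]
    · exact h
  have key : A * binaryQuad A B C z = (A * z.1 + B * z.2) ^ 2 + (A * C - B ^ 2) * z.2 ^ 2 := by
    simp only [binaryQuad]; ring
  refine pos_of_mul_pos_right (b := binaryQuad A B C z) ?_ hA
  rw [key]
  by_cases h2 : z.2 = 0
  · have h1 : z.1 ≠ 0 := fun h => hz (Prod.ext h h2)
    rw [h2]
    have : 0 < (A * z.1) ^ 2 := by positivity
    simpa using this
  · positivity

/-- A real function that is homogeneous of degree two and nonnegative on the unit sphere of the
plane is nonnegative. -/
lemma nonneg_of_nonneg_on_sphere {f : ℝ × ℝ → ℝ} (hf : ∀ (c : ℝ) z, f (c • z) = c ^ 2 * f z)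
    (h : ∀ z ∈ Metric.sphere (0 : ℝ × ℝ) 1, 0 ≤ f z) (z : ℝ × ℝ) : 0 ≤ f z := by
  by_cases hz : z = 0
  · have := hf 0 0
    simp only [smul_zero] at this
    rw [hz, this]; simp
  · have hn : ‖z‖ ≠ 0 := norm_ne_zero_iff.2 hz
    have h1 := h (‖z‖⁻¹ • z) (by simp [norm_smul, hn])
    have h2 := hf ‖z‖ (‖z‖⁻¹ • z)
    rw [smul_inv_smul₀ hn] at h2
    rw [h2]; positivity


/-- Among the nonnegative quadratic forms below `F` there is one of maximal determinant. -/
lemma exists_binaryQuad_max_det {F : ℝ × ℝ → ℝ} (hF : Continuous F)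
    (hhom : ∀ (c : ℝ) z, F (c • z) = c ^ 2 * F z)
    (hpos : ∀ z, z ≠ 0 → 0 < F z) :
    ∃ A B C : ℝ, 0 ≤ A ∧ 0 < A * C - B ^ 2 ∧ (∀ z, binaryQuad A B C z ≤ F z) ∧
      ∀ A' B' C' : ℝ, 0 ≤ A' → 0 ≤ C' → (∀ z, binaryQuad A' B' C' z ≤ F z) →
        A' * C' - B' ^ 2 ≤ A * C - B ^ 2 := by
  let K : Set (ℝ × ℝ × ℝ) := {k | 0 ≤ k.1 ∧ 0 ≤ k.2.2 ∧ 0 ≤ k.1 * k.2.2 - k.2.1 ^ 2 ∧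
    ∀ z, binaryQuad k.1 k.2.1 k.2.2 z ≤ F z}
  have hKc : IsCompact K := by
    set M := F (1, 0) + F (0, 1)
    refine (isCompact_Icc (a := ((0, -M, 0) : ℝ × ℝ × ℝ))
      (b := (F (1, 0), M, F (0, 1)))).of_isClosed_subset ?_ ?_
    · simp only [K, binaryQuad, Set.ofPred_and, Set.ofPred_forall]
      refine IsClosed.inter ?_ (IsClosed.inter ?_ (IsClosed.inter ?_ (isClosed_iInter fun z => ?_)))
      all_goals exact isClosed_le (by fun_prop) (by fun_prop)
    · rintro ⟨A, B, C⟩ ⟨hA, hC, hD, hle⟩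
      have h1 := hle (1, 0)
      have h2 := hle (0, 1)
      simp only [binaryQuad] at h1 h2 hA hC hD
      norm_num at h1 h2
      have hB : |B| ≤ M := abs_le_of_sq_le_sq (by nlinarith) (by simp only [M]; linarith)
      rw [abs_le] at hB
      exact ⟨⟨hA, hB.1, hC⟩, ⟨h1, hB.2, h2⟩⟩
  obtain ⟨z₀, hz₀, hmin⟩ := (isCompact_sphere (0 : ℝ × ℝ) 1).exists_isMinOn
    (NormedSpace.sphere_nonempty.2 zero_le_one) hF.continuousOn
  have hm : 0 < F z₀ := hpos _ (by rintro rfl; simp at hz₀)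
  have hball : ∀ z, binaryQuad (F z₀ / 2) 0 (F z₀ / 2) z ≤ F z := by
    intro z
    rw [← sub_nonneg]
    refine nonneg_of_nonneg_on_sphere (f := fun z => F z - binaryQuad (F z₀ / 2) 0 (F z₀ / 2) z)
      (fun c z => by simp only [hhom, binaryQuad_smul]; ring) (fun z hz => ?_) z
    have h1 : F z₀ ≤ F z := hmin hz
    have h2 : ‖z‖ = 1 := by simpa using hz
    have h3 : |z.1| ≤ 1 := h2 ▸ norm_fst_le z
    have h4 : |z.2| ≤ 1 := h2 ▸ norm_snd_le z
    have h5 := (sq_le_one_iff_abs_le_one _).2 h3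
    have h6 := (sq_le_one_iff_abs_le_one _).2 h4
    simp only [binaryQuad]
    nlinarith
  obtain ⟨⟨A, B, C⟩, ⟨hA, hC, hD, hle⟩, hmax⟩ := hKc.exists_isMaxOn
    (f := fun k => k.1 * k.2.2 - k.2.1 ^ 2)
    ⟨(F z₀ / 2, 0, F z₀ / 2), by simp only; positivity, by simp only; positivity,
      by simp only; ring_nf; positivity, hball⟩ (by fun_prop)
  have hmax' : ∀ A' B' C' : ℝ, 0 ≤ A' → 0 ≤ C' → (∀ z, binaryQuad A' B' C' z ≤ F z) →
      A' * C' - B' ^ 2 ≤ A * C - B ^ 2 := by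
    intro A' B' C' hA' hC' hle'
    by_cases hD' : 0 ≤ A' * C' - B' ^ 2
    · exact hmax (a := (A', B', C')) ⟨hA', hC', hD', hle'⟩
    · exact (not_le.1 hD').le.trans hD
  refine ⟨A, B, C, hA, ?_, hle, hmax'⟩
  have := hmax' _ _ _ (by positivity) (by positivity) hball
  nlinarith

/-- A form of maximal determinant below `F` touches `F` off any given line through the origin. -/
lemma exists_contact_off_line {F : ℝ × ℝ → ℝ} (hF : Continuous F)
    (hhom : ∀ (c : ℝ) z, F (c • z) = c ^ 2 * F z) {A B C : ℝ} (hA : 0 ≤ A)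
    (hD : 0 < A * C - B ^ 2) (hle : ∀ z, binaryQuad A B C z ≤ F z)
    (hmax : ∀ A' B' C' : ℝ, 0 ≤ A' → 0 ≤ C' → (∀ z, binaryQuad A' B' C' z ≤ F z) →
        A' * C' - B' ^ 2 ≤ A * C - B ^ 2) {p : ℝ × ℝ} (hp : p ≠ 0) :
    ∃ z, binaryQuad A B C z = F z ∧ p.1 * z.2 - p.2 * z.1 ≠ 0 := by
  by_contra! hcon
  set D := A * C - B ^ 2 with hDdef
  set P := binaryQuad A B C p with hP
  have hP0 : 0 < P := binaryQuad_pos hA hD hp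
  set b₁ := A * p.1 + B * p.2 with hb₁
  set b₂ := B * p.1 + C * p.2 with hb₂
  let g : ℝ × ℝ → ℝ := fun z =>
    2 * D * (p.1 * z.2 - p.2 * z.1) ^ 2 - (b₁ * z.1 + b₂ * z.2) ^ 2
  have hg : Continuous g := by fun_prop
  have hsum : ∀ z, P * binaryQuad A B C z =
      (b₁ * z.1 + b₂ * z.2) ^ 2 + D * (p.1 * z.2 - p.2 * z.1) ^ 2 := by
    intro z; simp only [hP, binaryQuad, hb₁, hb₂, hDdef]; ring
  obtain ⟨M, hM⟩ := (isCompact_sphere (0 : ℝ × ℝ) 1).exists_bound_of_continuousOn hg.continuousOn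
  have hZ : IsCompact (Metric.sphere (0 : ℝ × ℝ) 1 ∩ {z | 0 ≤ g z}) :=
    (isCompact_sphere _ _).inter_right (isClosed_le continuous_const hg)
  obtain ⟨δ, hδ, hδ'⟩ : ∃ δ > 0, ∀ z ∈ Metric.sphere (0 : ℝ × ℝ) 1 ∩ {z | 0 ≤ g z},
      δ ≤ F z - binaryQuad A B C z := by
    rcases (Metric.sphere (0 : ℝ × ℝ) 1 ∩ {z | 0 ≤ g z}).eq_empty_or_nonempty with he | hne
    · exact ⟨1, one_pos, by simp [he]⟩
    obtain ⟨z, ⟨hz1, hz2⟩, hz⟩ := hZ.exists_isMinOn hne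
      (f := fun z => F z - binaryQuad A B C z) (hF.sub (continuous_binaryQuad A B C)).continuousOn
    refine ⟨_, ?_, hz⟩
    refine (sub_nonneg.2 (hle z)).lt_of_ne' fun h => ?_
    have hw := hcon z (sub_eq_zero.1 h).symm
    have hz0 : z ≠ 0 := by rintro rfl; simp at hz1
    have h1 := hsum z
    simp only [g, hw, Set.mem_ofPred_eq] at hz2
    rw [hw] at h1
    have := mul_pos hP0 (binaryQuad_pos hA hD hz0)
    nlinarith
  obtain ⟨ε, hε, hεP, hεM⟩ : ∃ ε > 0, ε * P ≤ 1 / 4 ∧ ε * |M| ≤ δ := by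
    refine ⟨min (1 / (4 * P)) (δ / (|M| + 1)), by positivity, ?_, ?_⟩
    · calc _ ≤ 1 / (4 * P) * P := by gcongr; exact min_le_left _ _
        _ = 1 / 4 := by field_simp
    · calc _ ≤ δ / (|M| + 1) * |M| := by gcongr; exact min_le_right _ _
        _ ≤ δ / (|M| + 1) * (|M| + 1) := by gcongr; linarith
        _ = δ := by field_simp
  have hpert : ∀ z, binaryQuad (A + ε * (2 * D * p.2 ^ 2 - b₁ ^ 2))
      (B + ε * (-2 * D * p.1 * p.2 - b₁ * b₂)) (C + ε * (2 * D * p.1 ^ 2 - b₂ ^ 2)) z =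
      binaryQuad A B C z + ε * g z := by
    intro z; simp only [binaryQuad, g]; ring
  have hpert_nonneg : ∀ z, 0 ≤ binaryQuad A B C z + ε * g z := by
    intro z
    refine nonneg_of_mul_nonneg_right (a := P) ?_ hP0
    rw [mul_add, hsum z]
    simp only [g]
    have h1 : 0 ≤ (1 - ε * P) * (b₁ * z.1 + b₂ * z.2) ^ 2 :=
      mul_nonneg (by linarith) (sq_nonneg _)
    have h2 : 0 ≤ (1 + 2 * (ε * P)) * (D * (p.1 * z.2 - p.2 * z.1) ^ 2) := by positivity
    linarith
  have hA' := hpert_nonneg (1, 0)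
  have hC' := hpert_nonneg (0, 1)
  rw [← hpert] at hA' hC'
  have hdet := hmax (A + ε * (2 * D * p.2 ^ 2 - b₁ ^ 2))
    (B + ε * (-2 * D * p.1 * p.2 - b₁ * b₂)) (C + ε * (2 * D * p.1 ^ 2 - b₂ ^ 2))
    (by simpa [binaryQuad] using hA') (by simpa [binaryQuad] using hC') (fun z => by
      rw [← sub_nonneg, hpert]
      refine nonneg_of_nonneg_on_sphere (f := fun z => F z - (binaryQuad A B C z + ε * g z))
        (fun c z => by
          simp only [hhom, binaryQuad_smul, g, Prod.smul_fst, Prod.smul_snd, smul_eq_mul]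
          ring) (fun z hz => ?_) z
      by_cases hgz : 0 ≤ g z
      · have h1 := hδ' z ⟨hz, hgz⟩
        have h2 : g z ≤ |M| := (le_abs_self _).trans ((hM z hz).trans (le_abs_self M))
        have h3 := mul_le_mul_of_nonneg_left h2 hε.le
        linarith
      · have h1 := mul_nonneg hε.le (not_le.1 hgz |>.le |> neg_nonneg.2)
        have h2 := hle z
        linarith)
  have hdet' : (A + ε * (2 * D * p.2 ^ 2 - b₁ ^ 2)) * (C + ε * (2 * D * p.1 ^ 2 - b₂ ^ 2)) -
      (B + ε * (-2 * D * p.1 * p.2 - b₁ * b₂)) ^ 2 = D * ((1 - ε * P) * (1 + 2 * (ε * P))) := by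
    simp only [hP, binaryQuad, hb₁, hb₂, hDdef]; ring
  rw [hdet'] at hdet
  have h0 : 0 < ε * P := mul_pos hε hP0
  have h1 : 1 < (1 - ε * P) * (1 + 2 * (ε * P)) := by nlinarith
  nlinarith


/-- If the quadratic form `Q` minorizes `F`, and `F` satisfies the `(τ, υ)`-inequality on pairs of
equal value, then contact points of equal value combine to a contact point. -/
lemma contact_combination {F : ℝ × ℝ → ℝ} {A B C τ υ : ℝ}
    (hle : ∀ z, binaryQuad A B C z ≤ F z)
    (hineq : ∀ u v, F u = F v →
      F (υ • u + τ • v) + F (υ • v - τ • u) ≤ 2 * (τ ^ 2 + υ ^ 2) * F u)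
    {u v : ℝ × ℝ} (hu : binaryQuad A B C u = F u) (hv : binaryQuad A B C v = F v)
    (huv : F u = F v) : binaryQuad A B C (υ • u + τ • v) = F (υ • u + τ • v) := by
  have h1 := hineq u v huv
  have h2 := hle (υ • u + τ • v)
  have h3 := hle (υ • v - τ • u)
  have h4 : binaryQuad A B C (υ • u + τ • v) + binaryQuad A B C (υ • v - τ • u) =
      (τ ^ 2 + υ ^ 2) * (binaryQuad A B C u + binaryQuad A B C v) := by
    simp only [binaryQuad, Prod.fst_add, Prod.snd_add, Prod.fst_sub, Prod.snd_sub, Prod.smul_fst,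
      Prod.smul_snd, smul_eq_mul]
    ring
  rw [hu, hv, ← huv] at h4
  linarith

/-- Under the `(τ, υ)`-inequality, the segment between two independent contact points consists of
contact points. -/
lemma contact_segment {F : ℝ × ℝ → ℝ} (hF : Continuous F)
    (hhom : ∀ (c : ℝ) z, F (c • z) = c ^ 2 * F z) (hpos : ∀ z, z ≠ 0 → 0 < F z)
    {A B C τ υ : ℝ} (hτ : 0 < τ) (hυ : 0 < υ) (hle : ∀ z, binaryQuad A B C z ≤ F z)
    (hineq : ∀ u v, F u = F v →
      F (υ • u + τ • v) + F (υ • v - τ • u) ≤ 2 * (τ ^ 2 + υ ^ 2) * F u)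
    {p q : ℝ × ℝ} (hp : binaryQuad A B C p = F p) (hq : binaryQuad A B C q = F q)
    (hpq : p.1 * q.2 - p.2 * q.1 ≠ 0) {t : ℝ} (ht : t ∈ Set.Icc (0 : ℝ) 1) :
    binaryQuad A B C ((1 - t) • p + t • q) = F ((1 - t) • p + t • q) := by
  let z : ℝ → ℝ × ℝ := fun s => (1 - s) • p + s • q
  have hz : Continuous z := by fun_prop
  have hz0 : ∀ s, z s ≠ 0 := by
    intro s hs
    have h1 : (1 - s) * p.1 + s * q.1 = 0 := congrArg Prod.fst hs
    have h2 : (1 - s) * p.2 + s * q.2 = 0 := congrArg Prod.snd hs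
    have h3 : s * (p.1 * q.2 - p.2 * q.1) = 0 := by linear_combination p.1 * h2 - p.2 * h1
    have h4 : (1 - s) * (p.1 * q.2 - p.2 * q.1) = 0 := by linear_combination q.2 * h1 - q.1 * h2
    exact hpq (by linear_combination h3 + h4)
  have hcl : IsClosed {s | binaryQuad A B C (z s) = F (z s)} :=
    isClosed_eq ((continuous_binaryQuad A B C).comp hz) (hF.comp hz)
  obtain ⟨a, ⟨⟨ha0, hat⟩, ha⟩, hamax⟩ :=
    ((isCompact_Icc (a := (0 : ℝ)) (b := t)).inter_right hcl).exists_isGreatest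
      ⟨0, ⟨le_rfl, ht.1⟩, by simpa [z] using hp⟩
  obtain ⟨b, ⟨⟨htb, hb1⟩, hb⟩, hbmin⟩ :=
    ((isCompact_Icc (a := t) (b := (1 : ℝ))).inter_right hcl).exists_isLeast
      ⟨1, ⟨ht.2, le_rfl⟩, by simpa [z] using hq⟩
  rcases hat.eq_or_lt with rfl | hat
  · exact ha
  rcases htb.eq_or_lt with rfl | htb
  · exact hb
  exfalso
  have hrescale : ∀ s, F ((√(F (z s)))⁻¹ • z s) = 1 := by
    intro s
    have := hpos _ (hz0 s)
    rw [hhom, inv_pow, Real.sq_sqrt this.le, inv_mul_cancel₀ this.ne']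
  have hcontact : ∀ s, binaryQuad A B C (z s) = F (z s) →
      binaryQuad A B C ((√(F (z s)))⁻¹ • z s) = F ((√(F (z s)))⁻¹ • z s) := by
    intro s hs
    rw [binaryQuad_smul, hhom, hs]
  have hcomb := contact_combination hle hineq (hcontact a ha) (hcontact b hb)
    ((hrescale a).trans (hrescale b).symm)
  have hα : 0 < υ * (√(F (z a)))⁻¹ := mul_pos hυ (inv_pos.2 (Real.sqrt_pos.2 (hpos _ (hz0 a))))
  have hβ : 0 < τ * (√(F (z b)))⁻¹ := mul_pos hτ (inv_pos.2 (Real.sqrt_pos.2 (hpos _ (hz0 b))))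
  rw [smul_smul, smul_smul] at hcomb
  set α := υ * (√(F (z a)))⁻¹
  set β := τ * (√(F (z b)))⁻¹
  set c := (α * a + β * b) / (α + β) with hc
  have hcz : α • z a + β • z b = (α + β) • z c := by
    have : (α + β) * c = α * a + β * b := by rw [hc]; field_simp
    ext
    · simp only [z, Prod.fst_add, Prod.smul_fst, smul_eq_mul]
      linear_combination (p.1 - q.1) * this
    · simp only [z, Prod.snd_add, Prod.smul_snd, smul_eq_mul]
      linear_combination (p.2 - q.2) * this
  rw [hcz, binaryQuad_smul, hhom] at hcomb
  have hcC : binaryQuad A B C (z c) = F (z c) :=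
    mul_left_cancel₀ (by positivity) hcomb
  have hac : a < c := by rw [hc, lt_div_iff₀ (by positivity)]; nlinarith
  have hcb : c < b := by rw [hc, div_lt_iff₀ (by positivity)]; nlinarith
  rcases le_total c t with h | h
  · exact hac.not_ge (hamax ⟨⟨ha0.trans hac.le, h⟩, hcC⟩)
  · exact hcb.not_ge (hbmin ⟨⟨h, hcb.le.trans hb1⟩, hcC⟩)

/-- A positive definite, degree two homogeneous function on the plane which satisfies the
`(τ, υ)`-inequality is a quadratic form. -/
lemma eq_binaryQuad_of_ineq {F : ℝ × ℝ → ℝ} (hF : Continuous F)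
    (hhom : ∀ (c : ℝ) z, F (c • z) = c ^ 2 * F z) (hpos : ∀ z, z ≠ 0 → 0 < F z)
    {τ υ : ℝ} (hτ : 0 < τ) (hυ : 0 < υ)
    (hineq : ∀ u v, F u = F v →
      F (υ • u + τ • v) + F (υ • v - τ • u) ≤ 2 * (τ ^ 2 + υ ^ 2) * F u) :
    ∃ A B C : ℝ, ∀ z, F z = binaryQuad A B C z := by
  obtain ⟨A, B, C, hA, hD, hle, hmax⟩ := exists_binaryQuad_max_det hF hhom hpos
  obtain ⟨p, hp, hp1⟩ := exists_contact_off_line hF hhom hA hD hle hmax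
    (p := (1, 0)) (by simp)
  obtain ⟨q, hq, hpq⟩ := exists_contact_off_line hF hhom hA hD hle hmax
    (p := p) (by rintro rfl; simp at hp1)
  refine ⟨A, B, C, ?_⟩
  have hneg : ∀ z, F (-z) = F z := fun z => by simpa using hhom (-1) z
  have hneg' : ∀ z, binaryQuad A B C (-z) = binaryQuad A B C z := fun z => by
    simpa using binaryQuad_smul A B C (-1) z
  have hcone : ∀ q' : ℝ × ℝ, binaryQuad A B C q' = F q' → p.1 * q'.2 - p.2 * q'.1 ≠ 0 →
      ∀ a b : ℝ, 0 ≤ a → 0 ≤ b → F (a • p + b • q') = binaryQuad A B C (a • p + b • q') := by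
    intro q' hq' hpq' a b ha hb
    rcases (add_nonneg ha hb).eq_or_lt with h | h
    · have h1 : a = 0 := by linarith
      have h2 : b = 0 := by linarith
      simpa [h1, h2, binaryQuad] using hhom 0 0
    have hseg := contact_segment hF hhom hpos hτ hυ hle hineq hp hq' hpq'
      (t := b / (a + b)) ⟨by positivity, (div_le_one h).2 (by linarith)⟩
    have : a • p + b • q' = (a + b) • ((1 - b / (a + b)) • p + (b / (a + b)) • q') := by
      rw [smul_add, smul_smul, smul_smul]
      congr 2 <;> field_simp
      ring
    rw [this, hhom, binaryQuad_smul, hseg]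
  intro z
  obtain ⟨a, b, rfl⟩ : ∃ a b : ℝ, z = a • p + b • q := by
    refine ⟨(z.1 * q.2 - z.2 * q.1) / (p.1 * q.2 - p.2 * q.1),
      (p.1 * z.2 - p.2 * z.1) / (p.1 * q.2 - p.2 * q.1), ?_⟩
    ext
    · simp only [Prod.fst_add, Prod.smul_fst, smul_eq_mul]
      rw [div_mul_eq_mul_div, div_mul_eq_mul_div, ← add_div, eq_div_iff hpq]
      ring
    · simp only [Prod.snd_add, Prod.smul_snd, smul_eq_mul]
      rw [div_mul_eq_mul_div, div_mul_eq_mul_div, ← add_div, eq_div_iff hpq]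
      ring
  have hpq' : p.1 * (-q).2 - p.2 * (-q).1 ≠ 0 := by
    simp only [Prod.fst_neg, Prod.snd_neg]
    contrapose! hpq
    linarith
  have hq' : binaryQuad A B C (-q) = F (-q) := by rw [hneg', hneg, hq]
  rcases le_total 0 a with ha | ha <;> rcases le_total 0 b with hb | hb
  · exact hcone q hq hpq a b ha hb
  · simpa using hcone (-q) hq' hpq' a (-b) ha (neg_nonneg.2 hb)
  · rw [← hneg, ← hneg']
    simpa [add_comm] using hcone (-q) hq' hpq' (-a) b (neg_nonneg.2 ha) hb
  · rw [← hneg, ← hneg']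
    simpa [add_comm] using hcone q hq hpq (-a) (-b) (neg_nonneg.2 ha) (neg_nonneg.2 hb)

/-- A real normed space satisfying the `(τ, υ)`-inequality on vectors of equal norm satisfies the
parallelogram law. -/
theorem parallelogram_law_of_ineq {X : Type*} [NormedAddCommGroup X] [NormedSpace ℝ X]
    {τ υ : ℝ} (hτ : 0 < τ) (hυ : 0 < υ)
    (hineq : ∀ u v : X, ‖u‖ = ‖v‖ →
      ‖υ • u + τ • v‖ ^ 2 + ‖υ • v - τ • u‖ ^ 2 ≤ 2 * (τ ^ 2 + υ ^ 2) * ‖u‖ ^ 2) (x y : X) :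
    ‖x + y‖ ^ 2 + ‖x - y‖ ^ 2 = 2 * ‖x‖ ^ 2 + 2 * ‖y‖ ^ 2 := by
  by_cases hxy : LinearIndependent ℝ ![x, y]
  · let L : ℝ × ℝ → X := fun z => z.1 • x + z.2 • y
    have hL0 : ∀ z, L z = 0 → z = 0 := fun z hz =>
      Prod.ext_iff.2 (LinearIndependent.pair_iff.1 hxy z.1 z.2 hz)
    have hLadd : ∀ z w, L (z + w) = L z + L w := fun z w => by
      simp only [L, Prod.fst_add, Prod.snd_add]; module
    have hLsmul : ∀ (c : ℝ) z, L (c • z) = c • L z := fun c z => by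
      simp only [L, Prod.smul_fst, Prod.smul_snd, smul_eq_mul]; module
    have hLsub : ∀ z w, L (z - w) = L z - L w := fun z w => by
      simp only [L, Prod.fst_sub, Prod.snd_sub]; module
    obtain ⟨A, B, C, h⟩ := eq_binaryQuad_of_ineq (F := fun z => ‖L z‖ ^ 2) (by fun_prop)
      (fun c z => by rw [hLsmul, norm_smul, mul_pow, Real.norm_eq_abs, sq_abs])
      (fun z hz => by have := norm_pos_iff.2 (mt (hL0 z) hz); positivity) hτ hυ
      (fun u v huv => by
        simp only [hLadd, hLsub, hLsmul]
        exact hineq _ _ ((sq_eq_sq₀ (norm_nonneg _) (norm_nonneg _)).1 huv))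
    have h1 := h (1, 0)
    have h2 := h (0, 1)
    have h3 := h (1, 1)
    have h4 := h (1, -1)
    simp only [L, binaryQuad] at h1 h2 h3 h4
    simp only [one_smul, zero_smul, add_zero, zero_add, neg_smul, ← sub_eq_add_neg] at h1 h2 h3 h4
    linear_combination h3 + h4 - 2 * h1 - 2 * h2
  · have hcol : ∀ (c d : ℝ) (e : X), ‖c • e + d • e‖ ^ 2 + ‖c • e - d • e‖ ^ 2 =
        2 * ‖c • e‖ ^ 2 + 2 * ‖d • e‖ ^ 2 := by
      intro c d e
      simp only [← add_smul, ← sub_smul, norm_smul, mul_pow, Real.norm_eq_abs, sq_abs]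
      ring
    by_cases hx : x = 0
    · simp [hx]; ring
    · rw [LinearIndependent.pair_iff' hx] at hxy
      push Not at hxy
      obtain ⟨d, rfl⟩ := hxy
      simpa using hcol 1 d x

/-- In the variables `x + y`, `x - y`, the constant `LIYJ` bounds the `(τ, υ)`-expression on
vectors of equal norm. -/
lemma norm_sq_add_norm_sq_le_LIYJ {X : Type*} [NormedAddCommGroup X] [NormedSpace ℝ X]
    {τ υ : ℝ} (hτ : 0 < τ) (hυ : 0 < υ) {u v : X} (huv : ‖u‖ = ‖v‖) :
    ‖υ • u + τ • v‖ ^ 2 + ‖υ • v - τ • u‖ ^ 2 ≤ LIYJ X τ υ * (υ ^ 2 * ‖u‖ ^ 2) := by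
  have hnum : ∀ x y : X, (τ + υ) • x + (υ - τ) • y = υ • (x + y) + τ • (x - y) ∧
      (υ - τ) • x - (τ + υ) • y = υ • (x - y) - τ • (x + y) :=
    fun x y => ⟨by module, by module⟩
  have hbound : ∀ u v : X, ‖u‖ = ‖v‖ →
      ‖υ • u + τ • v‖ ^ 2 + ‖υ • v - τ • u‖ ^ 2 ≤ 2 * (τ + υ) ^ 2 * ‖u‖ ^ 2 := by
    intro u v huv
    have h1 : ‖υ • u + τ • v‖ ≤ (τ + υ) * ‖u‖ := by
      refine (norm_add_le _ _).trans_eq ?_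
      rw [norm_smul, norm_smul, Real.norm_of_nonneg hτ.le, Real.norm_of_nonneg hυ.le, ← huv]
      ring
    have h2 : ‖υ • v - τ • u‖ ≤ (τ + υ) * ‖u‖ := by
      refine (norm_sub_le _ _).trans_eq ?_
      rw [norm_smul, norm_smul, Real.norm_of_nonneg hτ.le, Real.norm_of_nonneg hυ.le, ← huv]
      ring
    have h3 := pow_le_pow_left₀ (norm_nonneg _) h1 2
    have h4 := pow_le_pow_left₀ (norm_nonneg _) h2 2
    linarith [mul_pow (τ + υ) ‖u‖ 2]
  by_cases hu : u = 0
  · have hv : v = 0 := by rw [← norm_eq_zero, ← huv, hu, norm_zero]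
    simp [hu, hv]
  have hu' : 0 < ‖u‖ := norm_pos_iff.2 hu
  rw [← div_le_iff₀ (by positivity)]
  refine le_csSup ⟨2 * (τ + υ) ^ 2 / υ ^ 2, ?_⟩
    ⟨(1 / 2 : ℝ) • (u + v), (1 / 2 : ℝ) • (u - v), ?_, ?_, ?_⟩
  · rintro r ⟨x, y, -, hxy, rfl⟩
    rw [(hnum x y).1, (hnum x y).2]
    refine div_le_of_le_mul₀ (by positivity) (by positivity) ?_
    refine (hbound _ _ hxy).trans_eq ?_
    field_simp
  · intro h
    rw [Prod.mk.injEq] at h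
    refine hu ?_
    calc u = (1 / 2 : ℝ) • (u + v) + (1 / 2 : ℝ) • (u - v) := by module
      _ = 0 := by rw [h.1, h.2, add_zero]
  · unfold IsoOrth
    convert huv using 2 <;> module
  · rw [(hnum _ _).1, (hnum _ _).2]
    have h1 : (1 / 2 : ℝ) • (u + v) + (1 / 2 : ℝ) • (u - v) = u := by module
    have h2 : (1 / 2 : ℝ) • (u + v) - (1 / 2 : ℝ) • (u - v) = v := by module
    rw [h1, h2]

lemma LIYJ_one_one_of_parallelogram_law {X : Type*} [NormedAddCommGroup X] [NormedSpace ℝ X]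
    [Nontrivial X]
    (h : ∀ x y : X, ‖x + y‖ ^ 2 + ‖x - y‖ ^ 2 = 2 * ‖x‖ ^ 2 + 2 * ‖y‖ ^ 2) :
    LIYJ X 1 1 = 4 := by
  have hval : ∀ x y : X, (x, y) ≠ (0, 0) → IsoOrth x y →
      (‖((1 : ℝ) + 1) • x + ((1 : ℝ) - 1) • y‖ ^ 2 + ‖((1 : ℝ) - 1) • x - ((1 : ℝ) + 1) • y‖ ^ 2) /
        ((1 : ℝ) ^ 2 * ‖x + y‖ ^ 2) = 4 := by
    intro x y hne hxy
    have hpar := h x y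
    rw [← show ‖x + y‖ = ‖x - y‖ from hxy] at hpar
    have hpos : 0 < ‖x + y‖ ^ 2 := by
      rcases eq_or_ne x 0 with rfl | hx
      · have : 0 < ‖y‖ := norm_pos_iff.2 fun hy => hne (by rw [hy])
        rw [zero_add]; positivity
      · have : 0 < ‖x‖ := norm_pos_iff.2 hx
        nlinarith [sq_nonneg ‖y‖]
    rw [div_eq_iff (by positivity)]
    norm_num [norm_smul, mul_pow]
    linarith
  obtain ⟨e, he⟩ := exists_ne (0 : X)
  have hset : {r : ℝ | ∃ x y : X, (x, y) ≠ (0, 0) ∧ IsoOrth x y ∧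
      r = (‖((1 : ℝ) + 1) • x + ((1 : ℝ) - 1) • y‖ ^ 2 +
        ‖((1 : ℝ) - 1) • x - ((1 : ℝ) + 1) • y‖ ^ 2) / ((1 : ℝ) ^ 2 * ‖x + y‖ ^ 2)} = {4} := by
    ext r
    constructor
    · rintro ⟨x, y, hne, hxy, rfl⟩
      exact hval x y hne hxy
    · rintro rfl
      have hne : (e, (0 : X)) ≠ (0, 0) := by simpa using he
      have hiso : IsoOrth e 0 := by simp [IsoOrth]
      exact ⟨e, 0, hne, hiso, (hval e 0 hne hiso).symm⟩
  rw [LIYJ, hset, csSup_singleton]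

/-- A nontrivial real Banach space `X` is a Hilbert space
(norm satisfies the parallelogram law) iff there exist `τ₀, υ₀ > 0` with
`L^I_YJ(τ₀, υ₀, X) = 2(τ₀²+υ₀²)/υ₀²`. -/
theorem stmt13 (X : Type*) [NormedAddCommGroup X] [NormedSpace ℝ X] [CompleteSpace X]
    [Nontrivial X] :
    (∀ x y : X, ‖x + y‖ ^ 2 + ‖x - y‖ ^ 2 = 2 * ‖x‖ ^ 2 + 2 * ‖y‖ ^ 2) ↔
      ∃ τ₀ υ₀ : ℝ, 0 < τ₀ ∧ 0 < υ₀ ∧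
        LIYJ X τ₀ υ₀ = 2 * (τ₀ ^ 2 + υ₀ ^ 2) / υ₀ ^ 2 := by
  constructor
  · intro h
    refine ⟨1, 1, one_pos, one_pos, ?_⟩
    rw [LIYJ_one_one_of_parallelogram_law h]
    norm_num
  · rintro ⟨τ, υ, hτ, hυ, h⟩
    refine parallelogram_law_of_ineq hτ hυ fun u v huv => ?_
    refine (norm_sq_add_norm_sq_le_LIYJ hτ hυ huv).trans_eq ?_
    rw [h]
    field_simp
end
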